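/- Let m be a multisegment and [a,b] a segment, and suppose ε_{[a]}(m) ≥ 2. Then: (i) if D^Lang_{[a,b]}(m) ≠ ∞, then D_{[a]}(D^Lang_{[a,b]}(m)) = D^Lang_{[a,b]}(D_{[a]}(m)) and this common value is ≠ ∞; (ii) if D^Lang_{[a,b]}(D_{[a]}(m)) ≠ ∞, then D^Lang_{[a,b]}(m) ≠ ∞. -/

import Mathlib

namespace Multiseg

/-- A segment `[a,b]` on a fixed cuspidal line, encoded by its endpoints. -/
abbrev Seg := ℤ × ℤ

/-- A multiset of pairs is a multisegment when each pair is a genuine segment. -/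
def IsMS (m : Multiset Seg) : Prop := ∀ Δ ∈ m, Δ.1 ≤ Δ.2

/-- `Δ ≺ Δ'` : the segment `Δ` precedes `Δ'`. -/
def Prec (Δ Δ' : Seg) : Prop := Δ.1 < Δ'.1 ∧ Δ.2 < Δ'.2 ∧ Δ'.1 ≤ Δ.2 + 1

instance : DecidableRel Prec := fun _ _ => by unfold Prec; infer_instance

/-- `Δ ⊆ Δ'` as segments. -/
def SSub (Δ Δ' : Seg) : Prop := Δ'.1 ≤ Δ.1 ∧ Δ.2 ≤ Δ'.2

/-- `m[i]`, the segments of `m` starting at `i`. -/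
def startAt (m : Multiset Seg) (i : ℤ) : Multiset Seg := m.filter fun Δ => Δ.1 = i

/-- `m⟨i⟩`, the segments of `m` ending at `i`. -/
def endAt (m : Multiset Seg) (i : ℤ) : Multiset Seg := m.filter fun Δ => Δ.2 = i

/-- `m_{[a,b]} = {[a',b'] ∈ m : a ≤ a' ≤ b+1 ≤ b'+1}`. -/
def mRange (m : Multiset Seg) (a b : ℤ) : Multiset Seg :=
  m.filter fun Δ => a ≤ Δ.1 ∧ Δ.1 ≤ b + 1 ∧ b ≤ Δ.2

/-- Add the segment `[x,y]` to `m`, discarding it if it is void. -/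
def pushSeg (m : Multiset Seg) (x y : ℤ) : Multiset Seg :=
  if x ≤ y then m + {(x, y)} else m

def msetMax (s : Multiset ℤ) : Option ℤ :=
  if h : s = 0 then none else some (s.toFinset.max' (Multiset.toFinset_nonempty.mpr h))

def msetMin (s : Multiset ℤ) : Option ℤ :=
  if h : s = 0 then none else some (s.toFinset.min' (Multiset.toFinset_nonempty.mpr h))

/-- The longest segment of `m[i]`, if any. -/
def longStart (m : Multiset Seg) (i : ℤ) : Option Seg :=
  (msetMax ((startAt m i).map Prod.snd)).map fun y => (i, y)

/-- The shortest segment of `m[i]`, if any. -/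
def shortStart (m : Multiset Seg) (i : ℤ) : Option Seg :=
  (msetMin ((startAt m i).map Prod.snd)).map fun y => (i, y)

/-- The longest segment of `m⟨i⟩`, if any. -/
def longEnd (m : Multiset Seg) (i : ℤ) : Option Seg :=
  (msetMin ((endAt m i).map Prod.fst)).map fun x => (x, i)

/-- The shortest segment of `m⟨i⟩`, if any. -/
def shortEnd (m : Multiset Seg) (i : ℤ) : Option Seg :=
  (msetMax ((endAt m i).map Prod.fst)).map fun x => (x, i)

/-- One removal step of the `tds(·,c)` process: remove the longest segment `Δ''`
of `m[c+1]` and the longest segment `Δ'` of `m[c]` with `Δ' ≺ Δ''`. -/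
def tdsStep (m : Multiset Seg) (c : ℤ) : Option (Multiset Seg) :=
  match longStart m (c + 1) with
  | none => none
  | some Δ'' =>
    match msetMax (((startAt m c).filter fun Δ => Prec Δ Δ'').map Prod.snd) with
    | none => none
    | some y => some ((m.erase (c, y)).erase Δ'')

def tdsIterF (c : ℤ) : ℕ → Multiset Seg → Multiset Seg
  | 0, m => m
  | n + 1, m =>
    match tdsStep m c with
    | none => m
    | some m' => tdsIterF c n m'

/-- Iterate the `tds(·,c)` process until it terminates. -/
def tdsIter (c : ℤ) (m : Multiset Seg) : Multiset Seg := tdsIterF c m.card m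

/-- The `ρ`-derivative algorithm `𝒟_{[a]}`; the value `none` codes `∞`. -/
def Drho (a : ℤ) (m : Multiset Seg) : Option (Multiset Seg) :=
  (shortStart (tdsIter a m) a).map fun Δ => pushSeg (m.erase Δ) (a + 1) Δ.2

/-- `ε_{[a]}(m)`, the number of segments starting at `a` left after the
`tds(·,a)` process terminates. -/
def epsA (a : ℤ) (m : Multiset Seg) : ℕ := (startAt (tdsIter a m) a).card

/-- The next element of an upward sequence after `p`. -/
def usNext (n : Multiset Seg) (p : Seg) : Option Seg :=
  match msetMin ((n.filter fun Δ => Prec p Δ).map Prod.fst) with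
  | none => none
  | some aj =>
    (msetMax ((((n.filter fun Δ => Prec p Δ).filter fun Δ => Δ.1 = aj)).map Prod.snd)).map
      fun y => (aj, y)

def usAux (n : Multiset Seg) : ℕ → Seg → List Seg
  | 0, _ => []
  | fuel + 1, p =>
    match usNext n p with
    | none => []
    | some Δ => Δ :: usAux n fuel Δ

/-- The upward sequence `Us(n)` of maximally linked segments of `n`. -/
def usList (n : Multiset Seg) : List Seg :=
  match msetMin (n.map Prod.fst) with
  | none => []
  | some a1 =>
    match longStart n a1 with
    | none => []
    | some Δ1 => Δ1 :: usAux n n.card Δ1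

/-- The decomposition of a multisegment into successive upward sequences. -/
def usDecomp : ℕ → Multiset Seg → List (List Seg)
  | 0, _ => []
  | fuel + 1, n =>
    if n = 0 then [] else usList n :: usDecomp fuel (n - (usList n : Multiset Seg))

/-- `[x,y] ⊆ [u,v]` (with the void interval contained in anything). -/
def intSubB (x y u v : ℤ) : Bool := decide (y < x) || (decide (u ≤ x) && decide (y ≤ v))

/-- Find, in a row of an upward-sequence decomposition, the first segment `Δ`
whose removable free section contains `[s(Δ), top]`. -/
def findRowD : List Seg → ℤ → Option Seg
  | [], _ => none
  | [Δ], top => if intSubB Δ.1 top Δ.1 Δ.2 then some Δ else none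
  | Δ :: Δ' :: rest, top =>
    if intSubB Δ.1 top Δ.1 (Δ'.1 - 2) then some Δ else findRowD (Δ' :: rest) top

/-- The selection step of the Langlands derivative algorithm, scanning the rows
downwards from the last one; it records each selected segment together with the
start of its truncation. -/
def selAuxD (rows : List (List Seg)) : ℕ → ℤ → List (Seg × ℤ)
  | 0, _ => []
  | n + 1, top =>
    match findRowD (rows.getD n []) top with
    | some Δ => (Δ, top + 1) :: selAuxD rows n (Δ.1 - 1)
    | none => selAuxD rows n top

/-- The Langlands derivative algorithm `𝒟^Lang_{[a,b]}`; `none` codes `∞`. -/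
def DLang (a b : ℤ) (m : Multiset Seg) : Option (Multiset Seg) :=
  let m1 := mRange m a b
  let rows := usDecomp m1.card m1
  let sel := selAuxD rows rows.length b
  match sel.getLast? with
  | none => none
  | some (Δl, _) =>
    if Δl.1 = a then
      some (sel.foldl (fun acc p => pushSeg (acc.erase p.1) p.2 p.1.2) m)
    else none

/-- One removal step of the `tus(·,c)` process. -/
def tusStep (n : Multiset Seg) (c : ℤ) : Option (Multiset Seg) :=
  match shortStart n c with
  | none => none
  | some Δ' =>
    match msetMin (((startAt n (c + 1)).filter fun Δ => Prec Δ' Δ).map Prod.snd) with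
    | none => none
    | some y => some ((n.erase Δ').erase (c + 1, y))

def tusIterF (c : ℤ) : ℕ → Multiset Seg → Multiset Seg
  | 0, n => n
  | k + 1, n =>
    match tusStep n c with
    | none => n
    | some n' => tusIterF c k n'

/-- Iterate the `tus(·,c)` process until it terminates. -/
def tusIter (c : ℤ) (n : Multiset Seg) : Multiset Seg := tusIterF c n.card n

/-- The `ρ`-integral algorithm `ℐ_{[a]}` (always defined). -/
def Irho (a : ℤ) (n : Multiset Seg) : Multiset Seg :=
  match longStart (tusIter a n) (a + 1) with
  | none => n + {(a, a)}
  | some Δ => pushSeg (n.erase Δ) a Δ.2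

/-- The next element of a downward sequence after `p`. -/
def dsNext (n : Multiset Seg) (p : Seg) : Option Seg :=
  match msetMax ((n.filter fun Δ => Prec Δ p).map Prod.fst) with
  | none => none
  | some aq => shortStart n aq

def dsAux (n : Multiset Seg) : ℕ → Seg → List Seg
  | 0, _ => []
  | k + 1, p =>
    match dsNext n p with
    | none => []
    | some Δ => Δ :: dsAux n k Δ

/-- The downward sequence `Ds(n)` of minimal linked segments with the largest
starting. -/
def dsList (n : Multiset Seg) : List Seg :=
  match msetMax (n.map Prod.fst) with
  | none => []
  | some a1 =>
    match shortStart n a1 with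
    | none => []
    | some Δ1 => Δ1 :: dsAux n n.card Δ1

/-- The decomposition of a multisegment into successive downward sequences. -/
def dsDecomp : ℕ → Multiset Seg → List (List Seg)
  | 0, _ => []
  | k + 1, n =>
    if n = 0 then [] else dsList n :: dsDecomp k (n - (dsList n : Multiset Seg))

/-- Find, in a row of a downward-sequence decomposition, the segment whose set
of addable free points contains `pt`. -/
def findRowI (a : ℤ) : List Seg → ℤ → Option Seg
  | [], _ => none
  | [Δ], pt => if decide (a ≤ pt) && decide (pt ≤ Δ.1 - 1) then some Δ else none
  | Δ :: Δ' :: rest, pt =>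
    if decide (Δ'.1 + 1 ≤ pt) && decide (pt ≤ Δ.1 - 1) then some Δ
    else findRowI a (Δ' :: rest) pt

/-- The selection step of the Langlands integral algorithm; it records each
selected segment together with the start of its extension. -/
def selAuxI (a : ℤ) (rows : List (List Seg)) : ℕ → ℤ → List (Seg × ℤ)
  | 0, _ => []
  | n + 1, pt =>
    match findRowI a (rows.getD n []) pt with
    | some Δ => (Δ, pt) :: selAuxI a rows n Δ.1
    | none => selAuxI a rows n pt

/-- The Langlands integral algorithm `ℐ^Lang_{[a,b]}`. -/
def ILang (a b : ℤ) (m : Multiset Seg) : Multiset Seg :=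
  let m1 := mRange m a b
  let rows := dsDecomp m1.card m1
  let sel := selAuxI a rows rows.length a
  let base := sel.foldl (fun acc p => pushSeg (acc.erase p.1) p.2 p.1.2) m
  match sel.getLast? with
  | none => pushSeg base a b
  | some (Δl, _) => pushSeg base Δl.1 b

/-- `m` is in good range for `[a,b]`. -/
def GoodRange (m : Multiset Seg) (a b : ℤ) : Prop := mRange m a b = m

/-- `Θ`, the Gelfand–Kazhdan involution on multisegments. -/
def Theta (m : Multiset Seg) : Multiset Seg := m.map fun Δ => (-Δ.2, -Δ.1)

/-- The exotic duality `𝔻_r`. -/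
def Dual (r : ℤ) (m : Multiset Seg) : Multiset Seg :=
  m.map fun Δ => (-r + Δ.2 + 1, Δ.1 - 1)

/-- `𝔻_r^{[a,b]}`. -/
def DualAB (r a b : ℤ) (m : Multiset Seg) : Multiset Seg := Dual r m + {(b - r + 1, b)}

/-- The left Langlands derivative algorithm `𝒟^{Lang,L}_{[a,b]}`. -/
def DLangL (a b : ℤ) (m : Multiset Seg) : Option (Multiset Seg) :=
  (DLang (-b) (-a) (Theta m)).map Theta

/-- The left `ρ`-derivative algorithm `𝒟^{Lang,L}_{[a]}`. -/
def DrhoL (a : ℤ) (m : Multiset Seg) : Option (Multiset Seg) :=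
  (Drho (-a) (Theta m)).map Theta

/-- The next segment chosen by the MW algorithm after `p`. -/
def mwNext (m : Multiset Seg) (p : Seg) : Option Seg :=
  (msetMax (((endAt m (p.2 - 1)).filter fun Δ => Prec Δ p).map Prod.fst)).map
    fun x => (x, p.2 - 1)

def mwAux (m : Multiset Seg) : ℕ → Seg → List Seg
  | 0, _ => []
  | k + 1, p =>
    match mwNext m p with
    | none => []
    | some Δ => Δ :: mwAux m k Δ

/-- The ordered segments participating in the MW algorithm for `m`. -/
def mwList (m : Multiset Seg) : List Seg :=
  match msetMax (m.map Prod.snd) with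
  | none => []
  | some b0 =>
    match shortEnd m b0 with
    | none => []
    | some Δ0 => Δ0 :: mwAux m m.card Δ0

/-- `𝒟^MW(m)`. -/
def DMW (m : Multiset Seg) : Multiset Seg :=
  (mwList m).foldl (fun acc Δ => pushSeg (acc.erase Δ) Δ.1 (Δ.2 - 1)) m

/-- The first segment `Δ(m)` produced by the MW algorithm for `m`. -/
def mwFirstSeg (m : Multiset Seg) : Option Seg :=
  match (mwList m).head?, (mwList m).getLast? with
  | some Δ0, some Δk => some (Δk.1, Δ0.2)
  | _, _ => none

/-- The total relative length of a multisegment. -/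
def totalLen (m : Multiset Seg) : ℕ := (m.map fun Δ => (Δ.2 - Δ.1 + 1).toNat).sum

def sharpAux : ℕ → Multiset Seg → Multiset Seg
  | 0, _ => 0
  | k + 1, m =>
    if m = 0 then 0
    else
      match mwFirstSeg m with
      | none => 0
      | some Δ => Δ ::ₘ sharpAux k (DMW m)

/-- The Mœglin–Waldspurger involution `m^#`. -/
def msharp (m : Multiset Seg) : Multiset Seg := sharpAux (totalLen m) m

/-- `ε^MW_{[a,c]}(m)`, the multiplicity of `[a,c]` in `m^#`. -/
def epsMW (a c : ℤ) (m : Multiset Seg) : ℕ := (msharp m).count (a, c)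

/-- `m_i`: remove from `m` the participants of the first `i` runs of the MW
algorithm. -/
def mwStage (m : Multiset Seg) : ℕ → Multiset Seg
  | 0 => m
  | i + 1 => mwStage m i - (mwList (DMW^[i] m) : Multiset Seg)

/-- `MW_k(m)`: all segments ending at `k` participating in the first `r` runs
of the MW algorithm. -/
def MWkSet (m : Multiset Seg) (r : ℕ) (k : ℤ) : Multiset Seg :=
  ∑ i ∈ Finset.range r, (mwList (DMW^[i] m) : Multiset Seg).filter fun Δ => Δ.2 = k

def upNbrAux (m : Multiset Seg) : ℕ → Seg → Option (List Seg)
  | 0, p => some [p]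
  | k + 1, p =>
    match msetMin (((endAt m (p.2 + 1)).filter fun Δ => Prec p Δ).map Prod.fst) with
    | none => none
    | some x => (upNbrAux m k (x, p.2 + 1)).map fun l => p :: l

/-- The removal upward sequence of maximal linked segments in neighbors on `m`
ranging from `a-1` to `b` (if it exists). -/
def upSeqNbr (m : Multiset Seg) (a b : ℤ) : Option (List Seg) :=
  match longEnd m (a - 1) with
  | none => none
  | some Δ => upNbrAux m (b - (a - 1)).toNat Δ

def zelRemF (a b : ℤ) : ℕ → Multiset Seg → Multiset Seg
  | 0, m => m
  | k + 1, m =>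
    match upSeqNbr m a b with
    | none => m
    | some l => zelRemF a b k (m - (l : Multiset Seg))

/-- Repeatedly remove removal upward sequences of maximal linked segments in
neighbors ranging from `a-1` to `b`, until none exists. -/
def zelRem (a b : ℤ) (m : Multiset Seg) : Multiset Seg := zelRemF a b m.card m

def zelRemCountF (a b : ℤ) : ℕ → Multiset Seg → ℕ
  | 0, _ => 0
  | k + 1, m =>
    match upSeqNbr m a b with
    | none => 0
    | some l => zelRemCountF a b k (m - (l : Multiset Seg)) + 1

/-- The number of removal upward sequences of maximal linked segments in
neighbors ranging from `a-1` to `b` successively removed from `m`. -/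
def zelRemCount (a b : ℤ) (m : Multiset Seg) : ℕ := zelRemCountF a b m.card m

def downNbrAux (m : Multiset Seg) : ℕ → Seg → Option (List Seg)
  | 0, p => some [p]
  | k + 1, p =>
    match msetMax (((endAt m (p.2 - 1)).filter fun Δ => Prec Δ p).map Prod.fst) with
    | none => none
    | some x => (downNbrAux m k (x, p.2 - 1)).map fun l => p :: l

/-- The Zelevinsky derivative algorithm `𝒟^Zel_{[a,b]}`; `none` codes `∞`. -/
def DZel (a b : ℤ) (m : Multiset Seg) : Option (Multiset Seg) :=
  match shortEnd (zelRem a b m) b with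
  | none => none
  | some Δb =>
    match downNbrAux (zelRem a b m) (b - a).toNat Δb with
    | none => none
    | some l => some (l.foldl (fun acc Δ => pushSeg (acc.erase Δ) Δ.1 (Δ.2 - 1)) m)

/-- The downward sequence of minimal linked segments in neighbors on `m`
ranging from `b` to `a-1` (if it exists). -/
def downSeqNbr (m : Multiset Seg) (a b : ℤ) : Option (List Seg) :=
  match shortEnd m b with
  | none => none
  | some Δ => downNbrAux m (b - (a - 1)).toNat Δ

def izRemF (a b : ℤ) : ℕ → Multiset Seg → Multiset Seg
  | 0, m => m
  | k + 1, m =>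
    match downSeqNbr m a b with
    | none => m
    | some l => izRemF a b k (m - (l : Multiset Seg))

/-- Repeatedly remove downward sequences of minimal linked segments in
neighbors ranging from `b` to `a-1`, until none exists. -/
def izRem (a b : ℤ) (m : Multiset Seg) : Multiset Seg := izRemF a b m.card m

def extNext (m : Multiset Seg) (p : Seg) : Option Seg :=
  (msetMin (((endAt m (p.2 + 1)).filter fun Δ => Prec p Δ).map Prod.fst)).map
    fun x => (x, p.2 + 1)

def extAux (m : Multiset Seg) : ℕ → Option Seg → List (Option Seg)
  | 0, _ => []
  | k + 1, p =>
    let cur := p.bind (extNext m)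
    cur :: extAux m k cur

/-- The (possibly void) segments `Δ̃_{a-1}, …, Δ̃_{b-1}` participating in the
extension process of the Zelevinsky integral algorithm on `m`. -/
def extList (m : Multiset Seg) (a b : ℤ) : List (Option Seg) :=
  longEnd m (a - 1) :: extAux m (b - a).toNat (longEnd m (a - 1))

def applyExt : Multiset Seg → ℤ → List (Option Seg) → Multiset Seg
  | acc, _, [] => acc
  | acc, i, some Δ :: rest => applyExt (pushSeg (acc.erase Δ) Δ.1 (Δ.2 + 1)) (i + 1) rest
  | acc, i, none :: rest => applyExt (acc + {(i + 1, i + 1)}) (i + 1) rest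

/-- The Zelevinsky integral algorithm `ℐ^Zel_{[a,b]}`. -/
def IZel (a b : ℤ) (m : Multiset Seg) : Multiset Seg :=
  applyExt m (a - 1) (extList (izRem a b m) a b)

/-- `Δ̃⁺` for a possibly void `Δ̃` at position `i` (for the void segment at
position `i` this is the singleton `[i+1,i+1]`). -/
def plusAt (i : ℤ) : Option Seg → Seg
  | some Δ => (Δ.1, Δ.2 + 1)
  | none => (i + 1, i + 1)

def plusList : ℤ → List (Option Seg) → List Seg
  | _, [] => []
  | i, o :: rest => plusAt i o :: plusList (i + 1) rest

/-- `n₁` and `n₂` are linked by mapping: there is an injective map `f : n₁ → n₂`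
with `Δ ≺ f(Δ)` for all `Δ ∈ n₁`. -/
def LinkedByMapping (n₁ n₂ : Multiset Seg) : Prop :=
  ∃ n₂' ≤ n₂, Multiset.Rel Prec n₁ n₂'

def startsSorted (n : Multiset Seg) : List ℤ := (n.map Prod.fst).sort (· ≤ ·)

/-- `n₁' < n₁` for multisegments of segments ending at a common point, compared
via their sorted lists of starting points. -/
def MSLtStarts (n₁' n₁ : Multiset Seg) : Prop :=
  startsSorted n₁' ≠ startsSorted n₁ ∧
    List.Forall₂ (· ≤ ·) (startsSorted n₁) (startsSorted n₁')

/-- `n₁ ⊆ m⟨k-1⟩` and `n₂ ⊆ m⟨k⟩` are minimally linked in `m`. -/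
def MinLinked (m : Multiset Seg) (k : ℤ) (n₁ n₂ : Multiset Seg) : Prop :=
  n₁ ≤ endAt m (k - 1) ∧ n₂ ≤ endAt m k ∧ LinkedByMapping n₁ n₂ ∧
    (∀ n₁' ≤ endAt m (k - 1), LinkedByMapping n₁' n₂ → n₁'.card ≤ n₁.card) ∧
    (∀ n₁' ≤ endAt m (k - 1), n₁'.card = n₁.card → MSLtStarts n₁' n₁ →
      ¬LinkedByMapping n₁' n₂)

/-- The non-free sections of a row of an upward-sequence decomposition. -/
def nfRow : List Seg → Multiset Seg
  | [] => 0
  | [_] => 0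
  | Δ :: Δ' :: rest => pushSeg (nfRow (Δ' :: rest)) (Δ'.1 - 1) Δ.2

/-- `𝔡(m)`, the sum of all non-free sections. -/
def frakd (m : Multiset Seg) : Multiset Seg :=
  (usDecomp m.card m).foldl (fun acc row => acc + nfRow row) 0

def DrhoPow (t : ℤ) : ℕ → Multiset Seg → Option (Multiset Seg)
  | 0, m => some m
  | k + 1, m => (Drho t m).bind (DrhoPow t k)

/-- `(𝒟_{[a+n-1]})^{ε_{a+n-1}} ∘ ⋯ ∘ (𝒟_{[a]})^{ε_a}(m)` where at each stage `t`
the exponent is `ε_t = ε_{[t]}` of the current multisegment; `none` codes that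
some derivative in the composition is `∞`. -/
def hdComp : ℕ → ℤ → Multiset Seg → Option (Multiset Seg)
  | 0, _, m => some m
  | k + 1, t, m =>
    match DrhoPow t (epsA t m) m with
    | none => none
    | some m' => hdComp k (t + 1) m'


/-! ### Auxiliary notions -/

def Lt (p q : Seg) : Prop := p.1 < q.1 ∧ p.2 < q.2

def Good (a b : ℤ) (n : Multiset Seg) : Prop := ∀ Δ ∈ n, a ≤ Δ.1 ∧ Δ.1 ≤ b + 1 ∧ b ≤ Δ.2

/-- lexicographic preference: smaller start, then longer. -/
def Better (p q : Seg) : Prop := p.1 < q.1 ∨ (p.1 = q.1 ∧ q.2 ≤ p.2)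

inductive Chain (n : Multiset Seg) : Seg → List Seg → Prop
  | nil (p : Seg) (h : ∀ Δ ∈ n, ¬ Lt p Δ) : Chain n p []
  | cons (p Δ : Seg) (L : List Seg) (hm : Δ ∈ n) (hl : Lt p Δ)
      (hb : ∀ Δ' ∈ n, Lt p Δ' → Better Δ Δ') (hc : Chain n Δ L) : Chain n p (Δ :: L)

structure IsRow (n : Multiset Seg) (p : Seg) (L : List Seg) : Prop where
  mem : p ∈ n
  best : ∀ Δ ∈ n, Better p Δ
  chain : Chain n p L

inductive Dec : Multiset Seg → List (List Seg) → Prop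
  | nil : Dec 0 []
  | cons (n n1 : Multiset Seg) (p : Seg) (L : List Seg) (rows : List (List Seg))
      (hr : IsRow n p L) (hn : n = ((p :: L : List Seg) : Multiset Seg) + n1) (hd : Dec n1 rows) :
      Dec n ((p :: L) :: rows)

lemma Lt.trans {p q r : Seg} (h : Lt p q) (h' : Lt q r) : Lt p r :=
  ⟨h.1.trans h'.1, h.2.trans h'.2⟩

lemma Chain.congr {n n' : Multiset Seg} {p : Seg} {L : List Seg} (h : Chain n p L) :
    ∀ p', (∀ Δ, (Δ ∈ n ∧ Lt p Δ) ↔ (Δ ∈ n' ∧ Lt p' Δ)) → Chain n' p' L := by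
  induction h with
  | nil p h =>
    intro p' H
    exact Chain.nil _ fun Δ hΔ hl => h Δ ((H Δ).2 ⟨hΔ, hl⟩).1 ((H Δ).2 ⟨hΔ, hl⟩).2
  | cons p Δ L hm hl hb hc ih =>
    intro p' H
    have h1 := (H Δ).1 ⟨hm, hl⟩
    refine Chain.cons _ _ _ h1.1 h1.2 (fun Δ' h' hl' => ?_) (ih Δ fun Δ' => ?_)
    · have := (H Δ').2 ⟨h', hl'⟩
      exact hb Δ' this.1 this.2
    · constructor
      · rintro ⟨h2, h3⟩
        exact ⟨((H Δ').1 ⟨h2, hl.trans h3⟩).1, h3⟩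
      · rintro ⟨h2, h3⟩
        exact ⟨((H Δ').2 ⟨h2, h1.2.trans h3⟩).1, h3⟩

lemma Better.antisymm {p q : Seg} (h : Better p q) (h' : Better q p) : p = q := by
  unfold Better at *
  apply Prod.ext <;> omega

lemma Chain.unique {n : Multiset Seg} {p : Seg} {L : List Seg} (h : Chain n p L) :
    ∀ L', Chain n p L' → L = L' := by
  induction h with
  | nil p h =>
    intro L' h'
    cases h' with
    | nil => rfl
    | cons _ Δ L hm hl hb hc => exact absurd hl (h _ hm)
  | cons p Δ L hm hl hb hc ih =>
    intro L' h'
    cases h' with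
    | nil _ h => exact absurd hl (h _ hm)
    | cons _ Δ' L' hm' hl' hb' hc' =>
      have : Δ = Δ' := (hb _ hm' hl').antisymm (hb' _ hm hl)
      subst this
      rw [ih _ hc']

lemma Dec.unique {n : Multiset Seg} {rows : List (List Seg)} (h : Dec n rows) :
    ∀ rows', Dec n rows' → rows = rows' := by
  induction h with
  | nil =>
    intro rows' h'
    cases h' with
    | nil => rfl
    | cons _ n1 p L rows hr hn hd => exact absurd hr.mem (by simp)
  | cons n n1 p L rows hr hn hd ih =>
    intro rows' h'
    cases h' with
    | nil => exact absurd hr.mem (by simp)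
    | cons _ n1' p' L' rows' hr' hn' hd' =>
      have : p = p' := (hr.best _ hr'.mem).antisymm (hr'.best _ hr.mem)
      subst this
      have := hr.chain.unique _ hr'.chain
      subst this
      have : n1 = n1' := by
        rw [hn] at hn'
        exact add_left_cancel hn'
      subst this
      rw [ih _ hd']

lemma Chain.mem {n : Multiset Seg} {p : Seg} {L : List Seg} (h : Chain n p L) :
    ∀ Δ ∈ L, Δ ∈ n ∧ Lt p Δ := by
  induction h with
  | nil p h => simp
  | cons p Δ L hm hl hb hc ih =>
    intro Δ' h'
    rcases List.mem_cons.1 h' with rfl | h'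
    · exact ⟨hm, hl⟩
    · exact ⟨(ih _ h').1, hl.trans (ih _ h').2⟩

lemma Chain.nodup {n : Multiset Seg} {p : Seg} {L : List Seg} (h : Chain n p L) :
    (p :: L).Nodup := by
  induction h with
  | nil p h => simp
  | cons p Δ L hm hl hb hc ih =>
    refine List.nodup_cons.2 ⟨fun h => ?_, ih⟩
    have := (Chain.cons p Δ L hm hl hb hc).mem _ h
    exact absurd this.2.1 (lt_irrefl _)

lemma IsRow.le {n : Multiset Seg} {p : Seg} {L : List Seg} (h : IsRow n p L) :
    ((p :: L : List Seg) : Multiset Seg) ≤ n := by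
  rw [Multiset.le_iff_subset (by simpa using h.chain.nodup)]
  intro x hx
  rcases List.mem_cons.1 (Multiset.mem_coe.1 hx) with rfl | hx
  · exact h.mem
  · exact (h.chain.mem _ hx).1

/-- weight of a segment in the signature function. -/
def ind (a : ℤ) (e : ℤ) (Δ : Seg) : ℤ :=
  (if Δ.1 = a ∧ e ≤ Δ.2 then 1 else 0) - (if Δ.1 = a + 1 ∧ e < Δ.2 then 1 else 0)

/-- the signature function. -/
def phi (a : ℤ) (n : Multiset Seg) (e : ℤ) : ℤ := (n.map (ind a e)).sum

lemma phi_cons (a : ℤ) (Δ : Seg) (n : Multiset Seg) (e : ℤ) :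
    phi a (Δ ::ₘ n) e = ind a e Δ + phi a n e := by simp [phi]

lemma phi_add (a : ℤ) (n n' : Multiset Seg) (e : ℤ) :
    phi a (n + n') e = phi a n e + phi a n' e := by simp [phi]

lemma phi_zero (a : ℤ) (e : ℤ) : phi a 0 e = 0 := by simp [phi]

lemma ind_a (a e α : ℤ) : ind a e (a, α) = if e ≤ α then 1 else 0 := by
  simp [ind]

lemma ind_b (a e α : ℤ) : ind a e (a + 1, α) = -(if e < α then 1 else 0) := by
  simp [ind]

lemma ind_far (a e : ℤ) (Δ : Seg) (h : a + 2 ≤ Δ.1) : ind a e Δ = 0 := by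
  have h1 : Δ.1 ≠ a := by omega
  have h2 : Δ.1 ≠ a + 1 := by omega
  simp [ind, h1, h2]

lemma phi_far (a e : ℤ) (n : Multiset Seg) (h : ∀ Δ ∈ n, a + 2 ≤ Δ.1) : phi a n e = 0 := by
  unfold phi
  rw [Multiset.map_congr rfl (fun Δ hΔ => ind_far a e Δ (h Δ hΔ))]
  simp

lemma phi_le (a : ℤ) (n : Multiset Seg) (e e' : ℤ) (hee : e ≤ e')
    (h : ∀ y, (a, y) ∈ n → e ≤ y → e' ≤ y) : phi a n e ≤ phi a n e' := by
  unfold phi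
  apply Multiset.sum_map_le_sum_map
  rintro ⟨s, y⟩ hΔ
  simp only [ind]
  by_cases hs : s = a
  · subst hs
    have := h y hΔ
    split_ifs <;> omega
  · simp only [hs, false_and, if_false]
    split_ifs <;> omega

lemma phi_nonpos (a : ℤ) (n : Multiset Seg) (e : ℤ) (h : ∀ y, (a, y) ∈ n → y < e) :
    phi a n e ≤ 0 := by
  unfold phi
  apply Multiset.sum_induction (fun x : ℤ => x ≤ 0) _ (fun a b ha hb => by omega) le_rfl
  intro x hx
  obtain ⟨⟨s, y⟩, hΔ, rfl⟩ := Multiset.mem_map.1 hx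
  have h1 : ¬ (s = a ∧ e ≤ y) := by
    rintro ⟨rfl, h2⟩
    have := h y hΔ
    omega
  simp only [ind, h1, if_false]
  split_ifs <;> simp

lemma phi_nonneg (a : ℤ) (n : Multiset Seg) (e : ℤ) (h : ∀ y, (a + 1, y) ∈ n → y ≤ e) :
    0 ≤ phi a n e := by
  unfold phi
  apply Multiset.sum_induction (fun x : ℤ => 0 ≤ x) _ (fun a b ha hb => by omega) le_rfl
  intro x hx
  obtain ⟨⟨s, y⟩, hΔ, rfl⟩ := Multiset.mem_map.1 hx
  have h1 : ¬ (s = a + 1 ∧ e < y) := by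
    rintro ⟨rfl, h2⟩
    have := h y hΔ
    omega
  simp only [ind, h1, if_false]
  split_ifs <;> simp

/-- `M` is the maximum of `f`, and `e` the largest point where it is attained. -/
structure PK (f : ℤ → ℤ) (M e : ℤ) : Prop where
  le : ∀ x, f x ≤ M
  eq : f e = M
  lt : ∀ x, e < x → f x < M

lemma PK.unique {f : ℤ → ℤ} {M e e' : ℤ} (h : PK f M e) (h' : PK f M e') : e = e' := by
  rcases lt_trichotomy e e' with h1 | h1 | h1
  · have := h.lt _ h1
    have := h'.eq
    omega
  · exact h1
  · have := h'.lt _ h1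
    have := h.eq
    omega

lemma PK.mem {a : ℤ} {n : Multiset Seg} {M e : ℤ} (h : PK (phi a n) M e) : (a, e) ∈ n := by
  by_contra hn
  have h1 := phi_le a n e (e + 1) (by omega) (by
    intro y hy hey
    rcases hey.lt_or_eq with h2 | h2
    · omega
    · subst h2
      exact absurd hy hn)
  have := h.lt (e + 1) (by omega)
  have := h.eq
  omega

lemma PK_bump {f f' : ℤ → ℤ} {α β : ℤ}
    (hf : ∀ e, f' e = f e + if α < e ∧ e < β then 1 else 0)
    (hb : ∀ e, α < e → e < β → f' e ≤ f' β) (M e : ℤ) : PK f M e ↔ PK f' M e := by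
  have hβ : f' β = f β := by simp [hf]
  constructor
  · intro h
    have key : ¬ (α < e ∧ e < β) := by
      rintro ⟨h1, h2⟩
      have h3 := h.lt _ h2
      have h4 := hb e h1 h2
      have h5 := hf e
      rw [if_pos ⟨h1, h2⟩] at h5
      have := h.eq
      omega
    refine ⟨fun x => ?_, ?_, fun x hx => ?_⟩
    · by_cases hx : α < x ∧ x < β
      · have := hb x hx.1 hx.2
        have := h.le β
        omega
      · rw [hf, if_neg hx]
        simpa using h.le x
    · rw [hf, if_neg key]
      simpa using h.eq
    · by_cases hx' : α < x ∧ x < β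
      · have := hb x hx'.1 hx'.2
        have := h.lt β (by omega)
        omega
      · rw [hf, if_neg hx']
        simpa using h.lt x hx
  · intro h
    have key : ¬ (α < e ∧ e < β) := by
      rintro ⟨h1, h2⟩
      have h3 := h.lt _ h2
      have h4 := hb e h1 h2
      have := h.eq
      omega
    have hle : ∀ x, f x ≤ f' x := by
      intro x
      rw [hf]
      split_ifs <;> omega
    refine ⟨fun x => (hle x).trans (h.le x), ?_, fun x hx => (hle x).trans_lt (h.lt x hx)⟩
    have := hf e
    rw [if_neg key] at this
    have := h.eq
    omega

/-! ### The walk -/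

def wk (b : ℤ) : List (List Seg) → ℤ × Multiset Seg × Multiset Seg
  | [] => (b + 1, 0, 0)
  | R :: Rs =>
    let w := wk b Rs
    let Δ := (findRowD R (w.1 - 1)).getD (0, 0)
    (Δ.1, Δ ::ₘ w.2.1, (w.1, Δ.2) ::ₘ w.2.2)

def dl (a b : ℤ) (rows : List (List Seg)) (e : ℤ) : ℤ :=
  phi a (wk b rows).2.2 e - phi a (wk b rows).2.1 e

lemma wk_cons {b : ℤ} {R : List Seg} {Rs : List (List Seg)} {Δ : Seg}
    (h : findRowD R ((wk b Rs).1 - 1) = some Δ) :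
    wk b (R :: Rs) = (Δ.1, Δ ::ₘ (wk b Rs).2.1, ((wk b Rs).1, Δ.2) ::ₘ (wk b Rs).2.2) := by
  simp [wk, h]

lemma dl_cons {a b : ℤ} {R : List Seg} {Rs : List (List Seg)} {Δ : Seg}
    (h : findRowD R ((wk b Rs).1 - 1) = some Δ) (e : ℤ) :
    dl a b (R :: Rs) e = dl a b Rs e + ind a e ((wk b Rs).1, Δ.2) - ind a e Δ := by
  simp only [dl, wk_cons h, phi_cons]
  ring

lemma fr_spec : ∀ (R : List Seg) (p : Seg) (x : ℤ), p.1 ≤ x →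
    (∀ Δ ∈ p :: R, x - 1 ≤ Δ.2) →
    ∃ Δ ∈ p :: R, findRowD (p :: R) (x - 1) = some Δ ∧ Δ.1 ≤ x
  | [], p, x, hp, h => by
    have := h p (by simp)
    exact ⟨p, by simp, by simp [findRowD, intSubB, this], hp⟩
  | q :: R, p, x, hp, h => by
    by_cases hc : intSubB p.1 (x - 1) p.1 (q.1 - 2) = true
    · exact ⟨p, by simp, by simp [findRowD, hc], hp⟩
    · have hq : q.1 ≤ x := by
        simp [intSubB] at hc
        omega
      obtain ⟨Δ, h1, h2, h3⟩ := fr_spec R q x hq (fun Δ hΔ => h Δ (List.mem_cons_of_mem _ hΔ))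
      exact ⟨Δ, List.mem_cons_of_mem _ h1, by rw [findRowD, if_neg hc, h2], h3⟩

lemma fr_head (p : Seg) (R : List Seg) (x : ℤ) (hx : x = p.1) :
    findRowD (p :: R) (x - 1) = some p := by
  subst hx
  cases R <;> simp [findRowD, intSubB]

lemma fr_skip (a α β x : ℤ) (T : List Seg) (hx : a + 1 ≤ x) :
    findRowD ((a, α) :: (a + 1, β) :: T) (x - 1) = findRowD ((a + 1, β) :: T) (x - 1) := by
  rw [findRowD, if_neg]
  simp [intSubB]
  omega

lemma fr_cmp (a α x : ℤ) (T : List Seg) (hx : a + 1 ≤ x) (hT : ∀ Δ ∈ T, a + 2 ≤ Δ.1)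
    (hα : x - 1 ≤ α) (hT2 : ∀ Δ ∈ T, x - 1 ≤ Δ.2) :
    (findRowD ((a, α) :: T) (x - 1) = some (a, α) ∧
      findRowD ((a + 1, α) :: T) (x - 1) = some (a + 1, α)) ∨
    ∃ Δ ∈ T, findRowD ((a, α) :: T) (x - 1) = some Δ ∧
      findRowD ((a + 1, α) :: T) (x - 1) = some Δ := by
  cases T with
  | nil => left; simp [findRowD, intSubB, hα]
  | cons q T =>
    have hq := hT q (by simp)
    by_cases hc : x ≤ q.1 - 1
    · left
      have h1 : x - 1 ≤ q.1 - 2 := by omega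
      simp [findRowD, intSubB, h1]
    · right
      obtain ⟨Δ, h1, h2, h3⟩ := fr_spec T q x (by omega) hT2
      refine ⟨Δ, h1, ?_, ?_⟩
      · rw [findRowD, if_neg, h2]
        simp [intSubB]; omega
      · rw [findRowD, if_neg, h2]
        simp [intSubB]; omega

structure WkSpec (a b : ℤ) (n : Multiset Seg) (w : ℤ × Multiset Seg × Multiset Seg) : Prop where
  start : w.1 = b + 1 ∨ ∃ Δ ∈ n, Δ.1 = w.1
  le : w.1 ≤ b + 1
  ge : a ≤ w.1
  old_le : w.2.1 ≤ n
  old_ge : ∀ Δ ∈ w.2.1, w.1 ≤ Δ.1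
  new_ge : ∀ Δ ∈ w.2.2, w.1 ≤ Δ.1

lemma Good.mono {a b : ℤ} {n n' : Multiset Seg} (h : Good a b n) (hs : n' ⊆ n) : Good a b n' :=
  fun Δ hΔ => h Δ (hs hΔ)

lemma wk_spec {a b : ℤ} (hab : a ≤ b) {n : Multiset Seg} {rows : List (List Seg)}
    (h : Dec n rows) : Good a b n → WkSpec a b n (wk b rows) := by
  induction h with
  | nil =>
    intro _
    exact ⟨Or.inl rfl, le_rfl, by simp [wk]; omega, by simp [wk], by simp [wk], by simp [wk]⟩
  | cons n n1 p L rows hr hn hd ih =>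
    intro hg
    have hsub : n1 ⊆ n := by
      rw [hn]; exact Multiset.subset_of_le (Multiset.le_add_left _ _)
    have w := ih (hg.mono hsub)
    have hp := hg p hr.mem
    have hpx : p.1 ≤ (wk b rows).1 := by
      rcases w.start with h | ⟨Δ, hΔ, h⟩
      · omega
      · have := hr.best Δ (hsub hΔ)
        unfold Better at this
        omega
    have hmem : ∀ Δ ∈ p :: L, Δ ∈ n := by
      intro Δ hΔ
      rcases List.mem_cons.1 hΔ with rfl | hΔ
      · exact hr.mem
      · exact (hr.chain.mem _ hΔ).1
    obtain ⟨Δ, h1, h2, h3⟩ := fr_spec L p (wk b rows).1 hpx (by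
      intro Δ hΔ
      have := hg Δ (hmem Δ hΔ)
      have := w.le
      omega)
    rw [wk_cons h2]
    have := hg Δ (hmem Δ h1)
    have := w.le
    refine ⟨Or.inr ⟨Δ, hmem Δ h1, rfl⟩, by simp; omega, by simp; omega, ?_, ?_, ?_⟩
    · simp only
      rw [hn, ← Multiset.singleton_add]
      exact add_le_add (by simpa using h1) w.old_le
    · intro Δ' h'
      rcases Multiset.mem_cons.1 h' with rfl | h'
      · exact le_rfl
      · exact h3.trans (w.old_ge _ h')
    · intro Δ' h'
      rcases Multiset.mem_cons.1 h' with rfl | h'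
      · exact h3
      · exact h3.trans (w.new_ge _ h')

lemma dl_far {a b : ℤ} (hab : a ≤ b) {n : Multiset Seg} {rows : List (List Seg)}
    (h : Dec n rows) (hg : Good a b n) (hx : a + 2 ≤ (wk b rows).1) (e : ℤ) :
    dl a b rows e = 0 := by
  have w := wk_spec hab h hg
  rw [dl, phi_far, phi_far]
  · simp
  · exact fun Δ hΔ => hx.trans (w.old_ge _ hΔ)
  · exact fun Δ hΔ => hx.trans (w.new_ge _ hΔ)

lemma row_cases {n : Multiset Seg} {a α : ℤ} {L : List Seg} (hr : IsRow n (a, α) L) :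
    (∃ β T, L = (a + 1, β) :: T ∧ α < β ∧ (a + 1, β) ∈ n ∧ (∀ y, (a + 1, y) ∈ n → y ≤ β) ∧
      Chain n (a + 1, β) T ∧ ∀ Δ ∈ T, a + 2 ≤ Δ.1) ∨
    ((∀ y, (a + 1, y) ∈ n → y ≤ α) ∧ ∀ Δ ∈ L, a + 2 ≤ Δ.1) := by
  have hc := hr.chain
  cases hc with
  | nil _ h =>
    right
    refine ⟨fun y hy => ?_, by simp⟩
    have := h _ hy
    simp only [Lt] at this
    omega
  | cons _ Δ T hm hl hb hc =>
    obtain ⟨s, β⟩ := Δ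
    simp only [Lt] at hl
    by_cases hs : s = a + 1
    · subst hs
      left
      refine ⟨β, T, rfl, hl.2, hm, fun y hy => ?_, hc, fun Δ hΔ => ?_⟩
      · by_contra hlt
        have := hb _ hy ⟨by simp, by simp; omega⟩
        simp only [Better] at this
        omega
      · have := (hc.mem _ hΔ).2.1
        simp only at this
        omega
    · right
      refine ⟨fun y hy => ?_, fun Δ hΔ => ?_⟩
      · by_contra hlt
        have := hb _ hy ⟨by simp, by simp; omega⟩
        simp only [Better] at this
        omega
      · rcases List.mem_cons.1 hΔ with rfl | hΔ
        · simp only; omega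
        · have := (hc.mem _ hΔ).2.1
          simp only at this
          omega

lemma phi_row_un {n n1 : Multiset Seg} {a α : ℤ} {L : List Seg}
    (hn : n = (((a, α) :: L : List Seg) : Multiset Seg) + n1) (hL : ∀ Δ ∈ L, a + 2 ≤ Δ.1) (e : ℤ) :
    phi a n e = phi a n1 e + if e ≤ α then 1 else 0 := by
  rw [hn, phi_add, ← Multiset.cons_coe, phi_cons, ind_a, phi_far _ _ (L : Multiset Seg)]
  · ring
  · simpa using hL

lemma phi_row_m {n n1 : Multiset Seg} {a α β : ℤ} {T : List Seg}
    (hn : n = (((a, α) :: (a + 1, β) :: T : List Seg) : Multiset Seg) + n1)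
    (hL : ∀ Δ ∈ T, a + 2 ≤ Δ.1) (hαβ : α < β) (e : ℤ) :
    phi a n1 e = phi a n e + if α < e ∧ e < β then 1 else 0 := by
  rw [hn, phi_add, ← Multiset.cons_coe, phi_cons, ind_a, ← Multiset.cons_coe, phi_cons, ind_b,
    phi_far _ _ (T : Multiset Seg)]
  · split_ifs <;> omega
  · simpa using hL

lemma row_sub {n n1 : Multiset Seg} {R : List Seg} (hn : n = (R : Multiset Seg) + n1) :
    n1 ⊆ n := by
  rw [hn]; exact Multiset.subset_of_le (Multiset.le_add_left _ _)

lemma row_pick {a b : ℤ} (hab : a ≤ b) {n n1 : Multiset Seg} {p : Seg} {L : List Seg}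
    {rows : List (List Seg)} (hr : IsRow n p L)
    (hn : n = ((p :: L : List Seg) : Multiset Seg) + n1) (hd : Dec n1 rows) (hg : Good a b n) :
    p.1 ≤ (wk b rows).1 ∧ ∃ Δ ∈ p :: L, Δ ∈ n ∧
      findRowD (p :: L) ((wk b rows).1 - 1) = some Δ ∧ Δ.1 ≤ (wk b rows).1 := by
  have hsub := row_sub hn
  have w := wk_spec hab hd (hg.mono hsub)
  have hp := hg p hr.mem
  have hpx : p.1 ≤ (wk b rows).1 := by
    rcases w.start with h | ⟨Δ, hΔ, h⟩
    · omega
    · have := hr.best Δ (hsub hΔ)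
      unfold Better at this
      omega
  have hmem : ∀ Δ ∈ p :: L, Δ ∈ n := by
    intro Δ hΔ
    rcases List.mem_cons.1 hΔ with rfl | hΔ
    · exact hr.mem
    · exact (hr.chain.mem _ hΔ).1
  obtain ⟨Δ, h1, h2, h3⟩ := fr_spec L p (wk b rows).1 hpx (by
    intro Δ hΔ
    have := hg Δ (hmem Δ hΔ)
    have := w.le
    omega)
  exact ⟨hpx, Δ, h1, hmem Δ h1, h2, h3⟩

lemma row_head_a {a b : ℤ} {n : Multiset Seg} {p : Seg} {L : List Seg} (hr : IsRow n p L)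
    (hg : Good a b n) {y : ℤ} (hy : (a, y) ∈ n) : p = (a, p.2) ∧ ∀ y, (a, y) ∈ n → y ≤ p.2 := by
  have h1 := hg p hr.mem
  have h2 := hr.best _ hy
  simp only [Better] at h2
  have h3 : p.1 = a := by omega
  refine ⟨Prod.ext h3 rfl, fun y hy => ?_⟩
  have h2 := hr.best _ hy
  simp only [Better] at h2
  omega

lemma dl_one {a b : ℤ} (hab : a ≤ b) {n : Multiset Seg} {rows : List (List Seg)}
    (h : Dec n rows) : Good a b n → (wk b rows).1 = a + 1 →
    (a = b ∧ ∀ e, dl a b rows e = 0) ∨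
      ∃ β, (a + 1, β) ∈ n ∧ b ≤ β ∧ ∀ e, dl a b rows e = if e < β then 1 else 0 := by
  induction h with
  | nil =>
    intro _ hx
    simp [wk] at hx
    left
    exact ⟨hx.symm, fun e => by simp [dl, wk, phi_zero]⟩
  | cons n n1 p L rows hr hn hd ih =>
    intro hg hx
    obtain ⟨_, Δ, h1, h2, h3, h4⟩ := row_pick hab hr hn hd hg
    rw [wk_cons h3] at hx
    simp only at hx
    have hg1 := hg.mono (row_sub hn)
    obtain ⟨s, β⟩ := Δ
    simp only at hx h4
    subst hx
    by_cases hx1 : (wk b rows).1 = a + 1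
    · rcases ih hg1 hx1 with ⟨h5, h6⟩ | ⟨β', h5, h6, h7⟩
      · left
        refine ⟨h5, fun e => ?_⟩
        rw [dl_cons h3, h6, hx1]
        simp
      · right
        refine ⟨β', row_sub hn h5, h6, fun e => ?_⟩
        rw [dl_cons h3, h7, hx1]
        simp
    · right
      refine ⟨β, h2, (hg _ h2).2.2, fun e => ?_⟩
      rw [dl_cons h3, dl_far hab hd hg1 (by omega), ind_far _ _ _ (by simp; omega), ind_b]
      ring

/-- Row of matched type: what the walk does. -/
lemma pick_m {a b : ℤ} (hab : a ≤ b) {n n1 : Multiset Seg} {α β : ℤ} {T : List Seg}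
    {rows : List (List Seg)} (hr : IsRow n (a, α) ((a + 1, β) :: T))
    (hn : n = (((a, α) :: (a + 1, β) :: T : List Seg) : Multiset Seg) + n1) (hd : Dec n1 rows)
    (hg : Good a b n) (hT : ∀ Δ ∈ T, a + 2 ≤ Δ.1) (hx : a + 1 ≤ (wk b rows).1) :
    ∃ Δ ∈ (a + 1, β) :: T, findRowD ((a + 1, β) :: T) ((wk b rows).1 - 1) = some Δ ∧
      Δ.1 ≤ (wk b rows).1 ∧ (Δ = (a + 1, β) ∨ a + 2 ≤ Δ.1) := by
  have w := wk_spec hab hd (hg.mono (row_sub hn))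
  obtain ⟨Δ, h1, h2, h3⟩ := fr_spec T (a + 1, β) (wk b rows).1 hx (by
    intro Δ hΔ
    have := hg Δ (hr.chain.mem _ hΔ).1
    have := w.le
    omega)
  refine ⟨Δ, h1, h2, h3, ?_⟩
  rcases List.mem_cons.1 h1 with h | h
  · exact Or.inl h
  · exact Or.inr (hT _ h)

lemma phi_row_m_le {a α β : ℤ} {n n1 : Multiset Seg} (hs : n1 ⊆ n)
    (hmax : ∀ y, (a, y) ∈ n → y ≤ α) (e : ℤ) (h1 : α < e) (h2 : e < β) :
    phi a n1 e ≤ phi a n1 β := by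
  apply phi_le _ _ _ _ h2.le
  intro y hy hey
  have := hmax y (hs hy)
  omega

lemma SB {a b : ℤ} (hab : a < b) {n : Multiset Seg} {rows : List (List Seg)}
    (h : Dec n rows) : ∀ K, Good a b n → (∀ e, phi a n e ≤ K) → (wk b rows).1 = a →
    (∀ e, phi a n e + dl a b rows e ≤ K - 1) ∧ ∀ e < b, dl a b rows e = -1 := by
  induction h with
  | nil =>
    intro K _ _ hx
    simp [wk] at hx
    omega
  | cons n n1 p L rows hr hn hd ih =>
    intro K hg hK hx
    obtain ⟨hpx, Δ, h1, h2, h3, h4⟩ := row_pick hab.le hr hn hd hg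
    have hg1 := hg.mono (row_sub hn)
    have hx' := hx
    rw [wk_cons h3] at hx'
    simp only at hx'
    obtain ⟨hp, hmax⟩ := row_head_a hr hg (y := Δ.2) (by rw [← hx']; exact h2)
    generalize p.2 = α at hp hmax
    subst hp
    have w1 := wk_spec hab.le hd hg1
    rcases row_cases hr with ⟨β, T, rfl, hαβ, hβ, hβmax, hcT, hT⟩ | ⟨hβ, hL⟩
    · have hx1 : (wk b rows).1 = a := by
        by_contra hne
        have := w1.ge
        have hge : a + 1 ≤ (wk b rows).1 := by omega
        obtain ⟨Δ', h5, h6, h7, h8⟩ := pick_m hab.le hr hn hd hg hT hge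
        rw [fr_skip _ _ _ _ _ hge, h6] at h3
        cases h3
        rcases h8 with rfl | h8
        · simp at hx'
        · omega
      have hphi := phi_row_m hn hT hαβ
      have hK1 : ∀ e, phi a n1 e ≤ K := by
        intro e
        by_cases he : α < e ∧ e < β
        · have := phi_row_m_le (row_sub hn) hmax e he.1 he.2
          have h5 := hphi β
          simp at h5
          have := hK β
          omega
        · have h5 := hphi e
          rw [if_neg he] at h5
          have := hK e
          omega
      obtain ⟨h5, h6⟩ := ih K hg1 hK1 hx1
      have hdl : ∀ e, dl a b (((a, α) :: (a + 1, β) :: T) :: rows) e = dl a b rows e := by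
        intro e
        rw [dl_cons (fr_head _ _ _ hx1), hx1]
        simp
      refine ⟨fun e => ?_, fun e he => by rw [hdl, h6 e he]⟩
      rw [hdl]
      have := h5 e
      have := hphi e
      split_ifs at this <;> omega
    · have hphi := phi_row_un hn hL
      have hK0 : 1 ≤ K := by
        have h5 := hK α
        have h6 := phi_nonneg a n1 α (fun y hy => hβ y (row_sub hn hy))
        have := hphi α
        simp at this
        omega
      have hK1 : ∀ e, phi a n1 e ≤ K - 1 := by
        intro e
        have h5 := hphi e
        have := hK e
        split_ifs at h5 with he
        · omega
        · have := phi_nonpos a n1 e (fun y hy => by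
            have := hmax y (row_sub hn hy)
            omega)
          omega
      by_cases hx1 : (wk b rows).1 = a
      · obtain ⟨h5, h6⟩ := ih (K - 1) hg1 hK1 hx1
        have hdl : ∀ e, dl a b (((a, α) :: L) :: rows) e = dl a b rows e := by
          intro e
          rw [dl_cons (fr_head _ _ _ hx1), hx1]
          simp
        refine ⟨fun e => ?_, fun e he => by rw [hdl, h6 e he]⟩
        rw [hdl]
        have := h5 e
        have := hphi e
        split_ifs at this <;> omega
      · have hΔ : Δ = (a, α) := by
          rcases List.mem_cons.1 h1 with h | h
          · exact h
          · have := hL _ h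
            omega
        subst hΔ
        have hαb := (hg _ h2).2.2
        simp only at hαb
        by_cases hx2 : (wk b rows).1 = a + 1
        · rcases dl_one hab.le hd hg1 hx2 with h5 | ⟨β, h5, h6, h7⟩
          · omega
          · have := hβ β (row_sub hn h5)
            have hdl := dl_cons (a := a) h3
            simp only [hx2, ind_a, ind_b, h7] at hdl
            refine ⟨fun e => ?_, fun e he => ?_⟩
            · rw [hdl, hphi]
              have := hK1 e
              split_ifs <;> omega
            · rw [hdl]
              split_ifs <;> omega
        · have := w1.ge
          have hge : a + 2 ≤ (wk b rows).1 := by omega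
          have hdl := dl_cons (a := a) h3
          simp only [dl_far hab.le hd hg1 hge, ind_a, ind_far _ _ ((wk b rows).1, α) hge] at hdl
          refine ⟨fun e => ?_, fun e he => ?_⟩
          · rw [hdl, hphi]
            have := hK1 e
            split_ifs <;> omega
          · rw [hdl]
            split_ifs <;> omega

/-- Removing the longest segment at `a` when everything is matched. -/
lemma T2 {a b : ℤ} (hab : a ≤ b) {n : Multiset Seg} {rows : List (List Seg)}
    (h : Dec n rows) : Good a b n → (∀ e, phi a n e ≤ 0) → a + 1 ≤ (wk b rows).1 ∧
    ∀ α, (a, α) ∈ n → (∀ y, (a, y) ∈ n → y ≤ α) →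
      ∃ rows', Dec (n.erase (a, α)) rows' ∧ wk b rows' = wk b rows := by
  induction h with
  | nil =>
    intro _ _
    refine ⟨by simp [wk]; omega, by simp⟩
  | cons n n1 p L rows hr hn hd ih =>
    intro hg h0
    by_cases hex : ∃ y, (a, y) ∈ n
    swap
    · push Not at hex
      refine ⟨?_, fun α hα => absurd hα (hex α)⟩
      have w := wk_spec hab (Dec.cons n n1 p L rows hr hn hd) hg
      rcases w.start with h | ⟨⟨s, y⟩, h1, h2⟩
      · omega
      · have h3 := (hg _ h1).1
        have : s ≠ a := by
          rintro rfl
          exact hex _ h1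
        simp only at h2 h3
        omega
    obtain ⟨y, hy⟩ := hex
    obtain ⟨hp, hmax⟩ := row_head_a hr hg hy
    generalize p.2 = α at hp hmax
    subst hp
    have hg1 := hg.mono (row_sub hn)
    rcases row_cases hr with ⟨β, T, rfl, hαβ, hβ, hβmax, hcT, hT⟩ | ⟨hβ, hL⟩
    swap
    · exfalso
      have h6 := phi_nonneg a n1 α (fun y hy => hβ y (row_sub hn hy))
      have := phi_row_un hn hL α
      have := h0 α
      simp_all
      omega
    have hphi := phi_row_m hn hT hαβ
    have hK1 : ∀ e, phi a n1 e ≤ 0 := by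
      intro e
      by_cases he : α < e ∧ e < β
      · have := phi_row_m_le (row_sub hn) hmax e he.1 he.2
        have h5 := hphi β
        simp at h5
        have := h0 β
        omega
      · have h5 := hphi e
        rw [if_neg he] at h5
        have := h0 e
        omega
    obtain ⟨hge, ih2⟩ := ih hg1 hK1
    obtain ⟨Δ, h5, h6, h7, h8⟩ := pick_m hab hr hn hd hg hT hge
    have hfull : findRowD ((a, α) :: (a + 1, β) :: T) ((wk b rows).1 - 1) = some Δ := by
      rw [fr_skip _ _ _ _ _ hge, h6]
    refine ⟨?_, fun α' hα' hmax' => ?_⟩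
    · rw [wk_cons hfull]
      rcases h8 with rfl | h8
      · exact le_rfl
      · simp only; omega
    have : α' = α := le_antisymm (hmax _ hα') (hmax' _ hr.mem)
    subst this
    have hne : n.erase (a, α') = (((a + 1, β) :: T : List Seg) : Multiset Seg) + n1 := by
      rw [hn, ← Multiset.cons_coe, Multiset.cons_add, Multiset.erase_cons_head]
    have hmemne : ∀ Δ : Seg, a < Δ.1 → (Δ ∈ n.erase (a, α') ↔ Δ ∈ n) := by
      intro Δ hΔ
      apply Multiset.mem_erase_of_ne
      rintro rfl
      simp at hΔ
    by_cases hex1 : ∃ y, (a, y) ∈ n1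
    · -- next longest
      have hn1 : n1 ≠ 0 := by
        rintro rfl
        simp at hex1
      obtain ⟨y1, hy1⟩ := hex1
      cases hd with
      | nil => exact absurd rfl hn1
      | cons _ n2 p2 L2 rows2 hr2 hn2 hd2 =>
        obtain ⟨hp2, hmax2⟩ := row_head_a hr2 hg1 hy1
        generalize p2.2 = α2 at hp2 hmax2
        subst hp2
        obtain ⟨rows', hdec', hwk'⟩ := ih2 α2 hr2.mem hmax2
        have h2 : α2 ≤ α' := hmax _ (row_sub hn hr2.mem)
        have hdec : n.erase (a, α') =
            (((a, α2) :: (a + 1, β) :: T : List Seg) : Multiset Seg) + n1.erase (a, α2) := by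
          rw [hne, ← Multiset.cons_coe (a, α2), Multiset.cons_add, ← Multiset.add_cons,
            Multiset.cons_erase hr2.mem]
        have hrow : IsRow (n.erase (a, α')) (a, α2) ((a + 1, β) :: T) := by
          refine ⟨by rw [hdec]; simp, ?_, ?_⟩
          · intro Δ hΔ
            rw [hne] at hΔ
            rcases Multiset.mem_add.1 hΔ with hΔ | hΔ
            · left
              rcases List.mem_cons.1 (Multiset.mem_coe.1 hΔ) with rfl | hΔ
              · simp
              · have := hT _ hΔ
                simp only; omega
            · exact hr2.best _ hΔ
          · refine Chain.cons _ _ _ ((hmemne _ (by simp)).2 hβ) ⟨by simp, by simp; omega⟩ ?_ ?_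
            · rintro ⟨s, y⟩ hΔ hl
              simp only [Lt, Better] at *
              by_cases hs : s = a + 1
              · subst hs
                have := hβmax y ((hmemne _ (by simp)).1 hΔ)
                omega
              · omega
            · apply hcT.congr
              intro Δ
              constructor
              · rintro ⟨h9, h10⟩
                exact ⟨(hmemne _ (by have := h10.1; simp only at this; omega)).2 h9, h10⟩
              · rintro ⟨h9, h10⟩
                exact ⟨(hmemne _ (by have := h10.1; simp only at this; omega)).1 h9, h10⟩
        refine ⟨((a, α2) :: (a + 1, β) :: T) :: rows', Dec.cons _ _ _ _ _ hrow hdec hdec', ?_⟩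
        rw [wk_cons hfull, wk_cons (Δ := Δ), hwk']
        rw [hwk', fr_skip _ _ _ _ _ hge, h6]
    · push Not at hex1
      refine ⟨((a + 1, β) :: T) :: rows, Dec.cons _ _ _ _ _ ⟨?_, ?_, ?_⟩ hne hd, ?_⟩
      · rw [hne]; simp
      · rintro ⟨s, y⟩ hΔ
        have hn' := Multiset.mem_of_mem_erase hΔ
        have h9 := (hg _ hn').1
        have hs : s ≠ a := by
          rintro rfl
          rw [hne] at hΔ
          rcases Multiset.mem_add.1 hΔ with hΔ | hΔ
          · rcases List.mem_cons.1 (Multiset.mem_coe.1 hΔ) with h | hΔ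
            · simp at h
            · have := hT _ hΔ
              simp only at this; omega
          · exact hex1 _ hΔ
        simp only [Better] at *
        by_cases hs1 : s = a + 1
        · subst hs1
          have := hβmax y hn'
          omega
        · omega
      · apply hcT.congr
        intro Δ
        constructor
        · rintro ⟨h9, h10⟩
          exact ⟨(hmemne _ (by have := h10.1; simp only at this; omega)).2 h9, h10⟩
        · rintro ⟨h9, h10⟩
          exact ⟨(hmemne _ (by have := h10.1; simp only at this; omega)).1 h9, h10⟩
      · rw [wk_cons hfull, wk_cons h6]


def EE (a b : ℤ) (n : Multiset Seg) (rows rows' : List (List Seg)) (M e : ℤ) : Prop :=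
  (wk b rows').1 = (wk b rows).1 ∧
  (wk b rows).2.2 + (wk b rows').2.1 = (wk b rows').2.2 + (wk b rows).2.1 ∧
  ((wk b rows).1 = a → PK (fun x => phi a n x + dl a b rows x) (M - 1) e) ∧
  ((wk b rows).1 = a + 1 → ∃ β, e < β ∧ (a + 1, β) ∈ n ∧
    ∀ x, dl a b rows x = if x < β then 1 else 0)

def FF (a b : ℤ) (n : Multiset Seg) (rows rows' : List (List Seg)) (M e : ℤ) : Prop :=
  (wk b rows).1 = a ∧
  (M = 1 → (wk b rows').1 = a + 1 ∧
    (wk b rows').2.2 + (wk b rows).2.1 + {(a + 1, e)} =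
      (wk b rows).2.2 + (wk b rows').2.1 + {(a, e)} ∧
    (∀ x, phi a n x + dl a b rows x ≤ 0) ∧
    ∀ x, e ≤ x → -(if x ≤ e then 1 else 0) ≤ dl a b rows x) ∧
  (2 ≤ M → (wk b rows').1 = a ∧ ∃ e', (a, e') ∈ n ∧
    (wk b rows').2.2 + (wk b rows).2.1 + {(a + 1, e)} + {(a, e')} =
      (wk b rows).2.2 + (wk b rows').2.1 + {(a, e)} + {(a + 1, e')} ∧
    PK (fun x => phi a n x + dl a b rows x) (M - 1) e')

lemma dl_noop {a b : ℤ} {R : List Seg} {Rs : List (List Seg)} {Δ : Seg}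
    (h : findRowD R ((wk b Rs).1 - 1) = some Δ) (hx : (wk b Rs).1 = Δ.1) (e : ℤ) :
    dl a b (R :: Rs) e = dl a b Rs e := by
  rw [dl_cons h, hx]; simp

lemma row_mv {a α e : ℤ} {n n1 : Multiset Seg} {L : List Seg} (hr : IsRow n (a, α) L)
    (hn : n = (((a, α) :: L : List Seg) : Multiset Seg) + n1) (he : e ≤ α) (h1 : (a, e) ∈ n1) :
    IsRow ((a + 1, e) ::ₘ n.erase (a, e)) (a, α) L ∧
    (a + 1, e) ::ₘ n.erase (a, e) =
      (((a, α) :: L : List Seg) : Multiset Seg) + ((a + 1, e) ::ₘ n1.erase (a, e)) := by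
  have heq : (a + 1, e) ::ₘ n.erase (a, e) =
      (((a, α) :: L : List Seg) : Multiset Seg) + ((a + 1, e) ::ₘ n1.erase (a, e)) := by
    rw [hn, Multiset.erase_add_right_pos _ h1, Multiset.add_cons]
  refine ⟨⟨by rw [heq]; simp, ?_, ?_⟩, heq⟩
  · intro Δ hΔ
    rcases Multiset.mem_cons.1 hΔ with rfl | hΔ
    · left; simp
    · exact hr.best _ (Multiset.mem_of_mem_erase hΔ)
  · apply hr.chain.congr
    intro Δ
    constructor
    · rintro ⟨h2, h3⟩
      refine ⟨Multiset.mem_cons_of_mem ((Multiset.mem_erase_of_ne ?_).2 h2), h3⟩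
      rintro rfl
      simp [Lt] at h3
    · rintro ⟨h2, h3⟩
      refine ⟨?_, h3⟩
      rcases Multiset.mem_cons.1 h2 with rfl | h2
      · simp [Lt] at h3
        omega
      · exact Multiset.mem_of_mem_erase h2

/-- the case of the first row being unmatched with maximum one: the modified decomposition -/
lemma row_last {a b e : ℤ} (hab : a ≤ b) {n n1 : Multiset Seg} {L : List Seg}
    {rows : List (List Seg)} (hr : IsRow n (a, e) L)
    (hn : n = (((a, e) :: L : List Seg) : Multiset Seg) + n1) (hd : Dec n1 rows)
    (hg : Good a b n) (hβ : ∀ y, (a + 1, y) ∈ n → y ≤ e) (hL : ∀ Δ ∈ L, a + 2 ≤ Δ.1)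
    (h0 : ∀ x, phi a n1 x ≤ 0) :
    ∃ rows', Dec ((a + 1, e) ::ₘ n.erase (a, e)) rows' ∧
      ∀ Δ, findRowD ((a + 1, e) :: L) ((wk b rows).1 - 1) = some Δ →
        wk b rows' = (Δ.1, Δ ::ₘ (wk b rows).2.1, ((wk b rows).1, Δ.2) ::ₘ (wk b rows).2.2) := by
  have hg1 := hg.mono (row_sub hn)
  obtain ⟨hge, hT2⟩ := T2 hab hd hg1 h0
  have hne : (a + 1, e) ::ₘ n.erase (a, e) =
      (((a + 1, e) :: L : List Seg) : Multiset Seg) + n1 := by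
    rw [hn, ← Multiset.cons_coe, Multiset.cons_add, Multiset.erase_cons_head,
      ← Multiset.cons_coe, Multiset.cons_add]
  have hsub : ∀ Δ ∈ (a + 1, e) ::ₘ n.erase (a, e), Δ = (a + 1, e) ∨ Δ ∈ n := by
    intro Δ hΔ
    rcases Multiset.mem_cons.1 hΔ with h | h
    · exact Or.inl h
    · exact Or.inr (Multiset.mem_of_mem_erase h)
  have hmx : ∀ y, (a + 1, y) ∈ (a + 1, e) ::ₘ n.erase (a, e) → y ≤ e := by
    intro y hy
    rcases hsub _ hy with h | h
    · simp at h; omega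
    · exact hβ _ h
  have hch : Chain ((a + 1, e) ::ₘ n.erase (a, e)) (a + 1, e) L := by
    apply hr.chain.congr
    rintro ⟨s, y⟩
    constructor
    · rintro ⟨h2, h3⟩
      simp only [Lt] at h3
      have : s ≠ a + 1 := by
        rintro rfl
        have := hβ _ h2
        omega
      refine ⟨Multiset.mem_cons_of_mem ((Multiset.mem_erase_of_ne ?_).2 h2), ?_⟩
      · intro h
        simp at h
        omega
      · simp only [Lt]; omega
    · rintro ⟨h2, h3⟩
      simp only [Lt] at h3
      rcases hsub _ h2 with h | h
      · simp at h; omega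
      · refine ⟨h, ?_⟩
        simp only [Lt]; omega
  by_cases hex1 : ∃ y, (a, y) ∈ n1
  · have hn1 : n1 ≠ 0 := by
      rintro rfl
      simp at hex1
    obtain ⟨y1, hy1⟩ := hex1
    cases hd with
    | nil => exact absurd rfl hn1
    | cons _ n2 p2 L2 rows2 hr2 hn2 hd2 =>
      obtain ⟨hp2, hmax2⟩ := row_head_a hr2 hg1 hy1
      generalize p2.2 = α2 at hp2 hmax2
      subst hp2
      obtain ⟨rows', hdec', hwk'⟩ := hT2 α2 hr2.mem hmax2
      have h2 : α2 < e := by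
        rcases row_cases hr2 with ⟨β, T, -, hαβ, hβ2, -⟩ | ⟨hβ2, hL2⟩
        · have := hβ _ (row_sub hn hβ2)
          omega
        · exfalso
          have h6 := phi_nonneg a n2 α2 (fun y hy => hβ2 y (row_sub hn2 hy))
          have h7 := phi_row_un hn2 hL2 α2
          have := h0 α2
          simp at h7
          omega
      have hdec : (a + 1, e) ::ₘ n.erase (a, e) =
          (((a, α2) :: (a + 1, e) :: L : List Seg) : Multiset Seg) + n1.erase (a, α2) := by
        rw [hne, ← Multiset.cons_coe (a, α2), Multiset.cons_add, ← Multiset.add_cons,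
          Multiset.cons_erase hr2.mem]
      have hrow : IsRow ((a + 1, e) ::ₘ n.erase (a, e)) (a, α2) ((a + 1, e) :: L) := by
        refine ⟨by rw [hdec]; simp, ?_, ?_⟩
        · intro Δ hΔ
          rw [hne] at hΔ
          rcases Multiset.mem_add.1 hΔ with hΔ | hΔ
          · left
            rcases List.mem_cons.1 (Multiset.mem_coe.1 hΔ) with rfl | hΔ
            · simp
            · have := hL _ hΔ
              simp only; omega
          · exact hr2.best _ hΔ
        · refine Chain.cons _ _ _ (by simp) ⟨by simp, by simp; omega⟩ ?_ hch
          rintro ⟨s, y⟩ hΔ hl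
          simp only [Lt, Better] at *
          by_cases hs : s = a + 1
          · subst hs
            have := hmx y hΔ
            omega
          · omega
      refine ⟨((a, α2) :: (a + 1, e) :: L) :: rows', Dec.cons _ _ _ _ _ hrow hdec hdec', ?_⟩
      intro Δ hΔ
      rw [wk_cons (Δ := Δ), hwk']
      rw [hwk', fr_skip _ _ _ _ _ hge, hΔ]
  · push Not at hex1
    refine ⟨((a + 1, e) :: L) :: rows, Dec.cons _ _ _ _ _ ⟨by simp, ?_, hch⟩ hne hd,
      fun Δ hΔ => wk_cons hΔ⟩
    rintro ⟨s, y⟩ hΔ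
    have hΔ' := hΔ
    rw [hne] at hΔ'
    simp only [Better]
    rcases Multiset.mem_add.1 hΔ' with hΔ2 | hΔ2
    · rcases List.mem_cons.1 (Multiset.mem_coe.1 hΔ2) with h | hΔ2
      · simp at h; omega
      · have := hL _ hΔ2
        simp only at this; omega
    · have hs : s ≠ a := by
        rintro rfl
        exact hex1 _ hΔ2
      have h9 := (hg1 _ hΔ2).1
      simp only at h9
      by_cases hs1 : s = a + 1
      · subst hs1
        have := hmx y hΔ
        omega
      · omega

lemma eqE {N O N' O' : Multiset Seg} (h : N + O' = N' + O) (x y : Seg) :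
    (x ::ₘ N) + (y ::ₘ O') = (x ::ₘ N') + (y ::ₘ O) := by
  simp only [Multiset.cons_add, Multiset.add_cons, h]

lemma eqF {N O N' O' A B : Multiset Seg} (h : N' + O + A = N + O' + B) (x y : Seg) :
    (x ::ₘ N') + (y ::ₘ O) + A = (y ::ₘ N) + (x ::ₘ O') + B := by
  simp only [Multiset.cons_add, Multiset.add_cons, h]
  rw [Multiset.cons_swap]

lemma eqF2 {N O N' O' A B C D : Multiset Seg} (h : N' + O + A + B = N + O' + C + D) (x y : Seg) :
    (x ::ₘ N') + (y ::ₘ O) + A + B = (y ::ₘ N) + (x ::ₘ O') + C + D := by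
  simp only [Multiset.cons_add, Multiset.add_cons, h]
  rw [Multiset.cons_swap]


lemma S_matched {a b : ℤ} (hab : a ≤ b) {n n1 : Multiset Seg} {α β : ℤ} {T : List Seg}
    {rows rows1 : List (List Seg)} (hr : IsRow n (a, α) ((a + 1, β) :: T))
    (hn : n = (((a, α) :: (a + 1, β) :: T : List Seg) : Multiset Seg) + n1) (hd : Dec n1 rows)
    (hg : Good a b n) (hT : ∀ Δ ∈ T, a + 2 ≤ Δ.1) (hαβ : α < β)
    (hmax : ∀ y, (a, y) ∈ n → y ≤ α) {M e : ℤ} (heα : e ≤ α)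
    (h : EE a b n1 rows rows1 M e ∨ FF a b n1 rows rows1 M e) :
    EE a b n (((a, α) :: (a + 1, β) :: T) :: rows) (((a, α) :: (a + 1, β) :: T) :: rows1) M e ∨
    FF a b n (((a, α) :: (a + 1, β) :: T) :: rows) (((a, α) :: (a + 1, β) :: T) :: rows1) M e := by
  have hphi := phi_row_m hn hT hαβ
  have hg1 := hg.mono (row_sub hn)
  have w1 := wk_spec hab hd hg1
  rcases h with ⟨h1, h2, h3, h4⟩ | ⟨h1, h2, h3⟩
  · left
    by_cases hx : (wk b rows).1 = a
    · have hf := fr_head (a, α) ((a + 1, β) :: T) _ hx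
      have hf' := hf
      rw [← h1] at hf'
      have hw := wk_cons hf
      have hw' := wk_cons hf'
      refine ⟨by rw [hw, hw'], ?_, ?_, ?_⟩
      · rw [hw, hw', h1]
        exact eqE h2 _ _
      · intro _
        have h5 := h3 hx
        refine ⟨fun x => ?_, ?_, fun x hxe => ?_⟩
        · have := h5.le x
          have := hphi x
          simp only [dl_noop hf hx] at *
          split_ifs at this <;> omega
        · have := h5.eq
          have := hphi e
          simp only [dl_noop hf hx] at *
          rw [if_neg (by omega)] at this
          omega
        · have := h5.lt x hxe
          have := hphi x
          simp only [dl_noop hf hx] at *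
          split_ifs at this <;> omega
      · intro h
        rw [hw] at h
        simp at h
    · have hge : a + 1 ≤ (wk b rows).1 := by
        have := w1.ge
        omega
      obtain ⟨Δ, h5, h6, h7, h8⟩ := pick_m hab hr hn hd hg hT hge
      have hf : findRowD ((a, α) :: (a + 1, β) :: T) ((wk b rows).1 - 1) = some Δ := by
        rw [fr_skip _ _ _ _ _ hge, h6]
      have hf' := hf
      rw [← h1] at hf'
      have hw := wk_cons hf
      have hw' := wk_cons hf'
      refine ⟨by rw [hw, hw'], ?_, ?_, ?_⟩
      · rw [hw, hw', h1]
        exact eqE h2 _ _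
      · intro h
        rw [hw] at h
        simp only at h
        rcases h8 with rfl | h8
        · simp at h
        · omega
      · intro h
        rw [hw] at h
        simp only at h
        have hΔ : Δ = (a + 1, β) := by
          rcases h8 with rfl | h8
          · rfl
          · omega
        subst hΔ
        by_cases hx1 : (wk b rows).1 = a + 1
        · obtain ⟨β', h9, h10, h11⟩ := h4 hx1
          refine ⟨β', h9, row_sub hn h10, fun x => ?_⟩
          rw [dl_noop hf hx1, h11]
        · refine ⟨β, by omega, (hr.chain.mem _ h5).1, fun x => ?_⟩
          rw [dl_cons hf, dl_far hab hd hg1 (by omega), ind_far _ _ _ (by simp; omega), ind_b]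
          ring
  · right
    have hf := fr_head (a, α) ((a + 1, β) :: T) _ h1
    have hw := wk_cons hf
    refine ⟨by rw [hw], fun hM => ?_, fun hM => ?_⟩
    · obtain ⟨h4, h5, h6, h7⟩ := h2 hM
      have hf' : findRowD ((a, α) :: (a + 1, β) :: T) ((wk b rows1).1 - 1) = some (a + 1, β) := by
        rw [fr_skip _ _ _ _ _ (by omega), fr_head _ _ _ h4]
      have hw' := wk_cons hf'
      refine ⟨by rw [hw'], ?_, fun x => ?_, fun x hx => ?_⟩
      · rw [hw, hw', h1, h4]
        exact eqF h5 _ _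
      · have := h6 x
        have := hphi x
        rw [dl_noop hf h1]
        split_ifs at this <;> omega
      · rw [dl_noop hf h1]
        exact h7 x hx
    · obtain ⟨h4, e', h5, h6, h7⟩ := h3 hM
      have hf' := fr_head (a, α) ((a + 1, β) :: T) _ h4
      have hw' := wk_cons hf'
      refine ⟨by rw [hw'], e', row_sub hn h5, ?_, ?_⟩
      · rw [hw, hw', h1, h4]
        exact eqF2 h6 _ _
      · have heα' := hmax _ (row_sub hn h5)
        refine ⟨fun x => ?_, ?_, fun x hxe => ?_⟩
        · have := h7.le x
          have := hphi x
          simp only [dl_noop hf h1] at *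
          split_ifs at this <;> omega
        · have := h7.eq
          have := hphi e'
          simp only [dl_noop hf h1] at *
          rw [if_neg (by omega)] at this
          omega
        · have := h7.lt x hxe
          have := hphi x
          simp only [dl_noop hf h1] at *
          split_ifs at this <;> omega

lemma S_un2 {a b : ℤ} (hab : a ≤ b) {n n1 : Multiset Seg} {α : ℤ} {L : List Seg}
    {rows rows1 : List (List Seg)} (hr : IsRow n (a, α) L)
    (hn : n = (((a, α) :: L : List Seg) : Multiset Seg) + n1) (hd : Dec n1 rows)
    (hg : Good a b n) (hL : ∀ Δ ∈ L, a + 2 ≤ Δ.1) (hβ : ∀ y, (a + 1, y) ∈ n → y ≤ α)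
    (hmax : ∀ y, (a, y) ∈ n → y ≤ α) {M e : ℤ} (heα : e ≤ α) (hM : 2 ≤ M)
    (hpk : PK (phi a n1) (M - 1) e)
    (h : EE a b n1 rows rows1 (M - 1) e ∨ FF a b n1 rows rows1 (M - 1) e) :
    EE a b n (((a, α) :: L) :: rows) (((a, α) :: L) :: rows1) M e ∨
    FF a b n (((a, α) :: L) :: rows) (((a, α) :: L) :: rows1) M e := by
  have hphi := phi_row_un hn hL
  have hg1 := hg.mono (row_sub hn)
  have w1 := wk_spec hab hd hg1
  rcases h with ⟨h1, h2, h3, h4⟩ | ⟨h1, h2, h3⟩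
  · left
    obtain ⟨-, Δ, h5, h6, hf, h7⟩ := row_pick hab hr hn hd hg
    have hf' := hf
    rw [← h1] at hf'
    have hw := wk_cons hf
    have hw' := wk_cons hf'
    have hΔ : Δ = (a, α) ∨ a + 2 ≤ Δ.1 := by
      rcases List.mem_cons.1 h5 with h | h
      · exact Or.inl h
      · exact Or.inr (hL _ h)
    refine ⟨by rw [hw, hw'], ?_, ?_, ?_⟩
    · rw [hw, hw', h1]
      exact eqE h2 _ _
    · intro hX
      rw [hw] at hX
      simp only at hX
      have hΔ : Δ = (a, α) := by
        rcases hΔ with h | h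
        · exact h
        · omega
      subst hΔ
      by_cases hx : (wk b rows).1 = a
      · have h8 := h3 hx
        refine ⟨fun x => ?_, ?_, fun x hxe => ?_⟩
        · have := h8.le x
          simp only [dl_noop hf hx, hphi] at *
          split_ifs <;> omega
        · have := h8.eq
          simp only [dl_noop hf hx, hphi] at *
          rw [if_pos heα]
          omega
        · have := h8.lt x hxe
          simp only [dl_noop hf hx, hphi] at *
          split_ifs <;> omega
      · by_cases hx1 : (wk b rows).1 = a + 1
        · obtain ⟨β, h9, h10, h11⟩ := h4 hx1
          have h12 := hβ _ (row_sub hn h10)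
          have hdl := dl_cons (a := a) hf
          simp only [hx1, ind_a, ind_b, h11] at hdl
          refine ⟨fun x => ?_, ?_, fun x hxe => ?_⟩
          · have := hpk.le x
            simp only [hdl, hphi]
            split_ifs <;> omega
          · have := hpk.eq
            simp only [hdl, hphi]
            split_ifs <;> omega
          · have := hpk.lt x hxe
            simp only [hdl, hphi]
            split_ifs <;> omega
        · have := w1.ge
          have hge : a + 2 ≤ (wk b rows).1 := by omega
          have hdl := dl_cons (a := a) hf
          simp only [dl_far hab hd hg1 hge, ind_a, ind_far _ _ ((wk b rows).1, α) hge] at hdl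
          refine ⟨fun x => ?_, ?_, fun x hxe => ?_⟩
          · have := hpk.le x
            simp only [hdl, hphi]
            split_ifs <;> omega
          · have := hpk.eq
            simp only [hdl, hphi]
            split_ifs <;> omega
          · have := hpk.lt x hxe
            simp only [hdl, hphi]
            split_ifs <;> omega
    · intro hX
      rw [hw] at hX
      simp only at hX
      rcases hΔ with rfl | h
      · simp at hX
      · omega
  · right
    have hf := fr_head (a, α) L _ h1
    have hw := wk_cons hf
    refine ⟨by rw [hw], fun hM => by omega, fun _ => ?_⟩
    by_cases hM2 : M - 1 = 1
    · obtain ⟨h4, h5, h6, h7⟩ := h2 hM2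
      have hf' : findRowD ((a, α) :: L) ((wk b rows1).1 - 1) = some (a, α) := by
        have hαb := (hg _ hr.mem).2.2
        simp only at hαb
        obtain ⟨Δ, h8, h9, h10⟩ := fr_spec L (a, α) (wk b rows1).1 (by simp; omega) (by
          intro Δ hΔ
          have : Δ ∈ n := by
            rw [hn]; exact Multiset.mem_add.2 (Or.inl (Multiset.mem_coe.2 hΔ))
          have := hg _ this
          omega)
        rcases List.mem_cons.1 h8 with rfl | h
        · exact h9
        · have := hL _ h
          omega
      have hw' := wk_cons hf'
      refine ⟨by rw [hw'], α, hr.mem, ?_, ?_⟩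
      · rw [hw, hw', h1, h4]
        have := eqF h5 (a, α) (a, α)
        simp only [Multiset.cons_add] at this ⊢
        simp only [Multiset.add_cons, Multiset.cons_add] at this ⊢
        rw [Multiset.cons_inj_right, Multiset.cons_inj_right] at this
        rw [this, ← Multiset.singleton_add (a, α), ← Multiset.singleton_add (a, α),
          ← Multiset.singleton_add (a + 1, α)]
        rw [← Multiset.singleton_add (a, α)]
        abel
      · refine ⟨fun x => ?_, ?_, fun x hxe => ?_⟩
        · have := h6 x
          simp only [dl_noop hf h1, hphi]
          split_ifs <;> omega
        · have := h6 α
          have h9 := h7 α heα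
          have h10 := phi_nonneg a n1 α (fun y hy => hβ y (row_sub hn hy))
          simp only [dl_noop hf h1, hphi]
          rw [if_pos le_rfl]
          split_ifs at h9 with h11
          · have : α = e := le_antisymm h11 heα
            subst this
            have := hpk.eq
            omega
          · omega
        · have := h6 x
          simp only [dl_noop hf h1, hphi]
          rw [if_neg (by omega)]
          omega
    · obtain ⟨h4, e', h5, h6, h7⟩ := h3 (by omega)
      have hf' := fr_head (a, α) L _ h4
      have hw' := wk_cons hf'
      refine ⟨by rw [hw'], e', row_sub hn h5, ?_, ?_⟩
      · rw [hw, hw', h1, h4]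
        exact eqF2 h6 _ _
      · have heα' := hmax _ (row_sub hn h5)
        refine ⟨fun x => ?_, ?_, fun x hxe => ?_⟩
        · have := h7.le x
          simp only [dl_noop hf h1, hphi] at *
          split_ifs <;> omega
        · have := h7.eq
          simp only [dl_noop hf h1, hphi] at *
          rw [if_pos heα']
          omega
        · have := h7.lt x hxe
          simp only [dl_noop hf h1, hphi] at *
          split_ifs <;> omega

lemma S_un1 {a b : ℤ} (hab : a ≤ b) {n n1 : Multiset Seg} {e : ℤ} {L : List Seg}
    {rows : List (List Seg)} (hr : IsRow n (a, e) L)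
    (hn : n = (((a, e) :: L : List Seg) : Multiset Seg) + n1) (hd : Dec n1 rows)
    (hg : Good a b n) (hL : ∀ Δ ∈ L, a + 2 ≤ Δ.1) (hβ : ∀ y, (a + 1, y) ∈ n → y ≤ e)
    (h0 : ∀ x, phi a n1 x ≤ 0) :
    ∃ rows', Dec ((a + 1, e) ::ₘ n.erase (a, e)) rows' ∧
    (EE a b n (((a, e) :: L) :: rows) rows' 1 e ∨
    FF a b n (((a, e) :: L) :: rows) rows' 1 e) := by
  have hphi := phi_row_un hn hL
  have hg1 := hg.mono (row_sub hn)
  have w1 := wk_spec hab hd hg1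
  obtain ⟨hge, -⟩ := T2 hab hd hg1 h0
  obtain ⟨rows', hdec, hwk⟩ := row_last hab hr hn hd hg hβ hL h0
  refine ⟨rows', hdec, ?_⟩
  have hw1 := w1.le
  have heb := (hg _ hr.mem).2.2
  simp only at heb
  rcases fr_cmp a e (wk b rows).1 L hge hL (by omega) (by
      intro Δ hΔ
      have := hg _ (hr.chain.mem _ hΔ).1
      omega) with ⟨hf, hf'⟩ | ⟨Δ, hΔ, hf, hf'⟩
  · right
    have hw := wk_cons hf
    have hw' := hwk _ hf'
    refine ⟨by rw [hw], fun _ => ⟨by rw [hw'], ?_, ?_⟩, fun h => by omega⟩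
    · rw [hw, hw']
      simp only [← Multiset.singleton_add]
      abel
    · have hdl := dl_cons (a := a) hf
      by_cases hx1 : (wk b rows).1 = a + 1
      · rcases dl_one hab hd hg1 hx1 with ⟨h5, h6⟩ | ⟨β, h5, h6, h7⟩
        · simp only [hx1, ind_a, ind_b, h6] at hdl
          refine ⟨fun x => ?_, fun x hx => ?_⟩
          · have := h0 x
            simp only [hdl, hphi]
            split_ifs <;> omega
          · rw [hdl]
            split_ifs <;> omega
        · have := hβ _ (row_sub hn h5)
          simp only [hx1, ind_a, ind_b, h7] at hdl
          refine ⟨fun x => ?_, fun x hx => ?_⟩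
          · have := h0 x
            simp only [hdl, hphi]
            split_ifs <;> omega
          · rw [hdl]
            split_ifs <;> omega
      · have hge : a + 2 ≤ (wk b rows).1 := by omega
        simp only [dl_far hab hd hg1 hge, ind_a, ind_far _ _ ((wk b rows).1, e) hge] at hdl
        refine ⟨fun x => ?_, fun x hx => ?_⟩
        · have := h0 x
          simp only [hdl, hphi]
          split_ifs <;> omega
        · rw [hdl]
          split_ifs <;> omega
  · left
    have hw := wk_cons hf
    have hw' := hwk _ hf'
    have := hL _ hΔ
    refine ⟨by rw [hw, hw'], by rw [hw, hw'], ?_, ?_⟩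
    · intro h
      rw [hw] at h
      simp only at h
      omega
    · intro h
      rw [hw] at h
      simp only at h
      omega

lemma S {a b : ℤ} (hab : a ≤ b) {n : Multiset Seg} {rows : List (List Seg)} (h : Dec n rows) :
    ∀ M e, Good a b n → 1 ≤ M → PK (phi a n) M e →
    ∃ rows', Dec ((a + 1, e) ::ₘ n.erase (a, e)) rows' ∧
      (EE a b n rows rows' M e ∨ FF a b n rows rows' M e) := by
  induction h with
  | nil =>
    intro M e _ hM h
    exact absurd h.mem (by simp)
  | cons n n1 p L rows hr hn hd ih =>
    intro M e hg hM hpk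
    have hmem := hpk.mem
    obtain ⟨hp, hmax⟩ := row_head_a hr hg hmem
    generalize p.2 = α at hp hmax
    subst hp
    have hg1 := hg.mono (row_sub hn)
    have heα := hmax _ hmem
    rcases row_cases hr with ⟨β, T, rfl, hαβ, hβ, hβmax, hcT, hT⟩ | ⟨hβ, hL⟩
    · have hphi := phi_row_m hn hT hαβ
      have hpk1 : PK (phi a n1) M e :=
        (PK_bump hphi (phi_row_m_le (row_sub hn) hmax) M e).1 hpk
      obtain ⟨rows1, hd1, h1⟩ := ih M e hg1 hM hpk1
      obtain ⟨hr', hn'⟩ := row_mv hr hn heα hpk1.mem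
      exact ⟨_, Dec.cons _ _ _ _ _ hr' hn' hd1, S_matched hab hr hn hd hg hT hαβ hmax heα h1⟩
    · have hphi := phi_row_un hn hL
      have hnp : ∀ x, α < x → phi a n1 x ≤ 0 := fun x hx => phi_nonpos a n1 x (fun y hy => by
        have := hmax _ (row_sub hn hy)
        omega)
      by_cases hM2 : 2 ≤ M
      · have hpk1 : PK (phi a n1) (M - 1) e := by
          refine ⟨fun x => ?_, ?_, fun x hx => ?_⟩
          · have := hpk.le x
            have := hnp x
            have h5 := hphi x
            split_ifs at h5 <;> omega
          · have := hpk.eq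
            have h5 := hphi e
            split_ifs at h5; omega
          · have := hpk.lt x hx
            have := hnp x
            have h5 := hphi x
            split_ifs at h5 <;> omega
        obtain ⟨rows1, hd1, h1⟩ := ih (M - 1) e hg1 (by omega) hpk1
        obtain ⟨hr', hn'⟩ := row_mv hr hn heα hpk1.mem
        exact ⟨_, Dec.cons _ _ _ _ _ hr' hn' hd1,
          S_un2 hab hr hn hd hg hL hβ hmax heα hM2 hpk1 h1⟩
      · have hM1 : M = 1 := by omega
        subst hM1
        have hαe : α = e := by
          by_contra hne
          have h5 := hpk.lt α (by omega)
          have h6 := phi_nonneg a n1 α (fun y hy => hβ y (row_sub hn hy))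
          have h7 := hphi α
          simp at h7
          omega
        subst hαe
        have h0 : ∀ x, phi a n1 x ≤ 0 := by
          intro x
          have := hpk.le x
          have := hnp x
          have h5 := hphi x
          split_ifs at h5 <;> omega
        exact S_un1 hab hr hn hd hg hL hβ h0


lemma msetMax_some {s : Multiset ℤ} {y : ℤ} (h : msetMax s = some y) :
    y ∈ s ∧ ∀ z ∈ s, z ≤ y := by
  unfold msetMax at h
  split_ifs at h with h0
  simp only [Option.some.injEq] at h
  subst h
  refine ⟨Multiset.mem_toFinset.1 (Finset.max'_mem _ _), fun z hz => ?_⟩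
  exact Finset.le_max' _ _ (Multiset.mem_toFinset.2 hz)

lemma msetMax_none {s : Multiset ℤ} (h : msetMax s = none) : s = 0 := by
  unfold msetMax at h
  split_ifs at h with h0
  exact h0

lemma msetMin_some {s : Multiset ℤ} {y : ℤ} (h : msetMin s = some y) :
    y ∈ s ∧ ∀ z ∈ s, y ≤ z := by
  unfold msetMin at h
  split_ifs at h with h0
  simp only [Option.some.injEq] at h
  subst h
  refine ⟨Multiset.mem_toFinset.1 (Finset.min'_mem _ _), fun z hz => ?_⟩
  exact Finset.min'_le _ _ (Multiset.mem_toFinset.2 hz)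

lemma msetMin_none {s : Multiset ℤ} (h : msetMin s = none) : s = 0 := by
  unfold msetMin at h
  split_ifs at h with h0
  exact h0

lemma mem_startAt_snd {m : Multiset Seg} {i y : ℤ} :
    y ∈ (startAt m i).map Prod.snd ↔ (i, y) ∈ m := by
  simp only [startAt, Multiset.mem_map, Multiset.mem_filter]
  constructor
  · rintro ⟨⟨s, z⟩, ⟨h1, h2⟩, h3⟩
    simp only at h2 h3
    subst h2 h3
    exact h1
  · intro h
    exact ⟨(i, y), ⟨h, rfl⟩, rfl⟩

lemma longStart_some {m : Multiset Seg} {i : ℤ} {Δ : Seg} (h : longStart m i = some Δ) :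
    ∃ y, Δ = (i, y) ∧ (i, y) ∈ m ∧ ∀ z, (i, z) ∈ m → z ≤ y := by
  unfold longStart at h
  obtain ⟨y, hy, rfl⟩ := Option.map_eq_some_iff.1 h
  obtain ⟨h1, h2⟩ := msetMax_some hy
  exact ⟨y, rfl, mem_startAt_snd.1 h1, fun z hz => h2 z (mem_startAt_snd.2 hz)⟩

lemma longStart_none {m : Multiset Seg} {i : ℤ} (h : longStart m i = none) (z : ℤ) :
    (i, z) ∉ m := by
  unfold longStart at h
  have := msetMax_none (Option.map_eq_none_iff.1 h)
  intro hz
  have h2 := mem_startAt_snd.2 hz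
  rw [this] at h2
  simp at h2

lemma shortStart_some {m : Multiset Seg} {i : ℤ} {Δ : Seg} (h : shortStart m i = some Δ) :
    ∃ y, Δ = (i, y) ∧ (i, y) ∈ m ∧ ∀ z, (i, z) ∈ m → y ≤ z := by
  unfold shortStart at h
  obtain ⟨y, hy, rfl⟩ := Option.map_eq_some_iff.1 h
  obtain ⟨h1, h2⟩ := msetMin_some hy
  exact ⟨y, rfl, mem_startAt_snd.1 h1, fun z hz => h2 z (mem_startAt_snd.2 hz)⟩

lemma shortStart_none {m : Multiset Seg} {i : ℤ} (h : shortStart m i = none) (z : ℤ) :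
    (i, z) ∉ m := by
  unfold shortStart at h
  have := msetMin_none (Option.map_eq_none_iff.1 h)
  intro hz
  have h2 := mem_startAt_snd.2 hz
  rw [this] at h2
  simp at h2

lemma mem_prec_snd {m : Multiset Seg} {c y : ℤ} {Δ'' : Seg} :
    y ∈ ((startAt m c).filter fun Δ => Prec Δ Δ'').map Prod.snd ↔
      (c, y) ∈ m ∧ Prec (c, y) Δ'' := by
  simp only [startAt, Multiset.mem_map, Multiset.mem_filter]
  constructor
  · rintro ⟨⟨s, z⟩, ⟨⟨h1, h2⟩, h4⟩, h3⟩
    simp only at h2 h3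
    subst h2 h3
    exact ⟨h1, h4⟩
  · intro h
    exact ⟨(c, y), ⟨⟨h.1, rfl⟩, h.2⟩, rfl⟩

lemma tdsStep_some {m m' : Multiset Seg} {a : ℤ} (hm : IsMS m) (h : tdsStep m a = some m') :
    ∃ α β, m = (a, α) ::ₘ (a + 1, β) ::ₘ m' ∧ α < β ∧
      ∀ y, (a, y) ∈ m → α < y → β ≤ y := by
  unfold tdsStep at h
  split at h
  · simp at h
  · rename_i Δ hΔ
    obtain ⟨β, rfl, h1, h2⟩ := longStart_some hΔ
    split at h
    · simp at h
    · rename_i α hα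
      obtain ⟨h3, h4⟩ := msetMax_some hα
      rw [mem_prec_snd] at h3
      simp only [Option.some.injEq] at h
      have hp := h3.2
      simp only [Prec] at hp
      refine ⟨α, β, ?_, hp.2.1, ?_⟩
      · rw [← h, Multiset.cons_erase, Multiset.cons_erase h3.1]
        refine (Multiset.mem_erase_of_ne ?_).2 h1
        simp
      · intro y hy hlt
        by_contra hlt2
        have := h4 y (mem_prec_snd.2 ⟨hy, by simp [Prec], by simp; omega, by
          have := hm _ hy
          simp at this ⊢
          omega⟩)
        omega

lemma tdsStep_none {m : Multiset Seg} {a : ℤ} (hm : IsMS m) (h : tdsStep m a = none) :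
    ∀ y z, (a, y) ∈ m → (a + 1, z) ∈ m → z ≤ y := by
  intro y z hy hz
  unfold tdsStep at h
  split at h
  · rename_i h1
    exact absurd hz (longStart_none h1 z)
  · rename_i Δ hΔ
    obtain ⟨β, rfl, h1, h2⟩ := longStart_some hΔ
    split at h
    · rename_i h3
      have h3 := msetMax_none h3
      have := h2 _ hz
      by_contra hlt
      have h4 := (mem_prec_snd (m := m) (Δ'' := (a + 1, β)) (c := a) (y := y)).2
        ⟨hy, by simp [Prec], by simp; omega, by
          have := hm _ hy
          simp at this ⊢
          omega⟩
      rw [h3] at h4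
      simp at h4
    · simp at h

lemma tdsIterF_spec {a : ℤ} : ∀ (k : ℕ) (m : Multiset Seg), IsMS m → m.card ≤ k →
    tdsStep (tdsIterF a k m) a = none ∧ IsMS (tdsIterF a k m) ∧
    ∀ M e, PK (phi a m) M e ↔ PK (phi a (tdsIterF a k m)) M e := by
  intro k
  induction k with
  | zero =>
    intro m hm hk
    have : m = 0 := Multiset.card_eq_zero.1 (by omega)
    subst this
    refine ⟨?_, hm, fun M e => Iff.rfl⟩
    simp [tdsIterF, tdsStep, longStart, startAt, msetMax]
  | succ k ih =>
    intro m hm hk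
    rw [tdsIterF]
    cases hst : tdsStep m a with
    | none => exact ⟨hst, hm, fun M e => Iff.rfl⟩
    | some m' =>
      obtain ⟨α, β, h1, h2, h3⟩ := tdsStep_some hm hst
      have hsub : m' ⊆ m := by
        rw [h1]
        intro x hx
        simp [hx]
      obtain ⟨h4, h5, h6⟩ := ih m' (fun Δ hΔ => hm Δ (hsub hΔ)) (by
        rw [h1] at hk
        simp at hk
        omega)
      refine ⟨h4, h5, fun M e => ?_⟩
      rw [← h6 M e]
      apply PK_bump (α := α) (β := β)
      · intro x
        rw [h1, phi_cons, phi_cons, ind_a, ind_b]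
        split_ifs <;> omega
      · intro x hx1 hx2
        apply phi_le _ _ _ _ hx2.le
        intro y hy hxy
        exact h3 y (hsub hy) (by omega)

lemma startAt_cons (m : Multiset Seg) (Δ : Seg) (i : ℤ) :
    (startAt (Δ ::ₘ m) i).card = (startAt m i).card + if Δ.1 = i then 1 else 0 := by
  unfold startAt
  split_ifs with h <;> simp [h]

lemma phi_le_card (a : ℤ) (m : Multiset Seg) (x : ℤ) :
    phi a m x ≤ ((startAt m a).card : ℤ) := by
  induction m using Multiset.induction with
  | empty => simp [phi, startAt]
  | cons Δ m ih =>
    rw [phi_cons, startAt_cons]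
    unfold ind
    push_cast
    split_ifs <;> omega

lemma phi_eq_card (a : ℤ) (m : Multiset Seg) (x : ℤ) (h1 : ∀ y, (a, y) ∈ m → x ≤ y)
    (h2 : ∀ y, (a + 1, y) ∈ m → y ≤ x) :
    phi a m x = ((startAt m a).card : ℤ) := by
  induction m using Multiset.induction with
  | empty => simp [phi, startAt]
  | cons Δ m ih =>
    rw [phi_cons, startAt_cons]
    have ih := ih (fun y hy => h1 y (by simp [hy])) (fun y hy => h2 y (by simp [hy]))
    obtain ⟨s, z⟩ := Δ
    have h3 : s = a → x ≤ z := by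
      rintro rfl
      exact h1 z (by simp)
    have h4 : s = a + 1 → z ≤ x := by
      rintro rfl
      exact h2 z (by simp)
    simp only [ind]
    push_cast
    split_ifs <;> omega

lemma PK_final {m : Multiset Seg} {a e : ℤ} (hm : IsMS m) (h : tdsStep m a = none)
    (h1 : (a, e) ∈ m) (h2 : ∀ z, (a, z) ∈ m → e ≤ z) :
    PK (phi a m) ((startAt m a).card : ℤ) e := by
  refine ⟨phi_le_card a m, phi_eq_card a m e h2 (fun y hy => tdsStep_none hm h _ _ h1 hy), ?_⟩
  intro x hx
  rw [← Multiset.cons_erase h1, phi_cons, startAt_cons, ind_a, if_neg (by omega)]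
  have := phi_le_card a (m.erase (a, e)) x
  simp
  omega

lemma DR2 {m : Multiset Seg} {a : ℤ} (hm : IsMS m) (h : 1 ≤ epsA a m) :
    ∃ e, PK (phi a m) (epsA a m : ℤ) e := by
  obtain ⟨h1, h2, h3⟩ := tdsIterF_spec (a := a) m.card m hm le_rfl
  unfold epsA tdsIter at *
  cases hs : shortStart (tdsIterF a m.card m) a with
  | none =>
    exfalso
    have h4 : startAt (tdsIterF a m.card m) a ≠ 0 := by
      intro h0
      rw [h0] at h
      simp at h
    obtain ⟨⟨s, y⟩, hΔ⟩ := Multiset.exists_mem_of_ne_zero h4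
    simp only [startAt, Multiset.mem_filter] at hΔ
    obtain ⟨h5, rfl⟩ := hΔ
    exact shortStart_none hs y h5
  | some Δ =>
    obtain ⟨e, rfl, h4, h5⟩ := shortStart_some hs
    exact ⟨e, (h3 _ _).2 (PK_final h2 h1 h4 h5)⟩

lemma DR1 {m : Multiset Seg} {a M e : ℤ} (hm : IsMS m) (h : PK (phi a m) M e) :
    Drho a m = some (pushSeg (m.erase (a, e)) (a + 1) e) := by
  obtain ⟨h1, h2, h3⟩ := tdsIterF_spec (a := a) m.card m hm le_rfl
  have h4 := (h3 _ _).1 h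
  unfold Drho tdsIter
  cases hs : shortStart (tdsIterF a m.card m) a with
  | none => exact absurd h4.mem (shortStart_none hs e)
  | some Δ =>
    obtain ⟨e', rfl, h5, h6⟩ := shortStart_some hs
    have h7 := PK_final h2 h1 h5 h6
    have hM : M = ((startAt (tdsIterF a m.card m) a).card : ℤ) :=
      le_antisymm (by rw [← h4.eq]; exact h7.le _) (by rw [← h7.eq]; exact h4.le _)
    rw [← hM] at h7
    have := h4.unique h7
    subst this
    rfl


lemma prec_iff {a b : ℤ} {n : Multiset Seg} (hg : Good a b n) {p Δ : Seg} (hp : p ∈ n)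
    (hΔ : Δ ∈ n) : Prec p Δ ↔ Lt p Δ := by
  have h1 := hg p hp
  have h2 := hg Δ hΔ
  simp only [Prec, Lt]
  constructor
  · rintro ⟨h3, h4, -⟩
    exact ⟨h3, h4⟩
  · rintro ⟨h3, h4⟩
    exact ⟨h3, h4, by omega⟩

lemma usNext_none {a b : ℤ} {n : Multiset Seg} (hg : Good a b n) {p : Seg} (hp : p ∈ n)
    (h : usNext n p = none) : ∀ Δ ∈ n, ¬ Lt p Δ := by
  intro Δ hΔ hl
  unfold usNext at h
  split at h
  · rename_i h1
    have h1 := msetMin_none h1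
    have : Δ.1 ∈ (n.filter fun Δ => Prec p Δ).map Prod.fst :=
      Multiset.mem_map_of_mem _ (Multiset.mem_filter.2 ⟨hΔ, (prec_iff hg hp hΔ).2 hl⟩)
    rw [h1] at this
    simp at this
  · rename_i aj h1
    have h2 := (msetMin_some h1).1
    obtain ⟨Δ', h3, h4⟩ := Multiset.mem_map.1 h2
    have h5 := msetMax_none (Option.map_eq_none_iff.1 h)
    have : Δ'.2 ∈ ((n.filter fun Δ => Prec p Δ).filter fun Δ => Δ.1 = aj).map Prod.snd :=
      Multiset.mem_map_of_mem _ (Multiset.mem_filter.2 ⟨h3, h4⟩)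
    rw [h5] at this
    simp at this

lemma usNext_some {a b : ℤ} {n : Multiset Seg} (hg : Good a b n) {p Δ : Seg} (hp : p ∈ n)
    (h : usNext n p = some Δ) :
    Δ ∈ n ∧ Lt p Δ ∧ ∀ Δ' ∈ n, Lt p Δ' → Better Δ Δ' := by
  unfold usNext at h
  split at h
  · simp at h
  · rename_i aj h1
    obtain ⟨h2, h3⟩ := msetMin_some h1
    obtain ⟨y, hy, rfl⟩ := Option.map_eq_some_iff.1 h
    obtain ⟨h4, h5⟩ := msetMax_some hy
    obtain ⟨⟨s, y'⟩, h6, h7⟩ := Multiset.mem_map.1 h4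
    simp only at h7
    subst h7
    obtain ⟨h8, h9⟩ := Multiset.mem_filter.1 h6
    simp only at h9
    subst h9
    obtain ⟨h10, h11⟩ := Multiset.mem_filter.1 h8
    refine ⟨h10, (prec_iff hg hp h10).1 h11, ?_⟩
    intro Δ' h12 h13
    have h14 : Δ' ∈ n.filter fun Δ => Prec p Δ :=
      Multiset.mem_filter.2 ⟨h12, (prec_iff hg hp h12).2 h13⟩
    have h15 := h3 Δ'.1 (Multiset.mem_map_of_mem _ h14)
    unfold Better
    simp only
    by_cases h16 : Δ'.1 = s
    · right
      exact ⟨h16.symm, h5 _ (Multiset.mem_map_of_mem _ (Multiset.mem_filter.2 ⟨h14, h16⟩))⟩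
    · left
      omega

lemma usAux_chain {a b : ℤ} {n : Multiset Seg} (hg : Good a b n) : ∀ (k : ℕ) (p : Seg), p ∈ n →
    (n.filter fun Δ => p.1 < Δ.1).card ≤ k → Chain n p (usAux n k p) := by
  intro k
  induction k with
  | zero =>
    intro p hp hk
    rw [usAux]
    refine Chain.nil _ fun Δ hΔ hl => ?_
    have h0 : (n.filter fun Δ => p.1 < Δ.1) = 0 := Multiset.card_eq_zero.1 (by omega)
    have : Δ ∈ n.filter fun Δ => p.1 < Δ.1 := Multiset.mem_filter.2 ⟨hΔ, hl.1⟩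
    rw [h0] at this
    simp at this
  | succ k ih =>
    intro p hp hk
    rw [usAux]
    cases h : usNext n p with
    | none => exact Chain.nil _ (usNext_none hg hp h)
    | some Δ =>
      obtain ⟨h1, h2, h3⟩ := usNext_some hg hp h
      refine Chain.cons _ _ _ h1 h2 h3 (ih Δ h1 ?_)
      have hle : (n.filter fun Δ' => Δ.1 < Δ'.1) ≤ n.filter fun Δ => p.1 < Δ.1 := by
        apply Multiset.monotone_filter_right
        intro q hq
        have := h2.1
        omega
      have hlt : (n.filter fun Δ' => Δ.1 < Δ'.1) < n.filter fun Δ => p.1 < Δ.1 := by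
        refine lt_of_le_of_ne hle fun heq => ?_
        have h4 : Δ ∈ n.filter fun Δ => p.1 < Δ.1 := Multiset.mem_filter.2 ⟨h1, h2.1⟩
        rw [← heq] at h4
        simp at h4
      have := Multiset.card_lt_card hlt
      omega

lemma usList_row {a b : ℤ} {n : Multiset Seg} (hg : Good a b n) (h0 : n ≠ 0) :
    ∃ p L, usList n = p :: L ∧ IsRow n p L := by
  unfold usList
  split
  · rename_i h
    exact absurd (Multiset.map_eq_zero.1 (msetMin_none h)) h0
  · rename_i a1 h
    obtain ⟨h1, h2⟩ := msetMin_some h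
    obtain ⟨⟨s, y⟩, h3, h4⟩ := Multiset.mem_map.1 h1
    simp only at h4
    subst h4
    split
    · rename_i h5
      exact absurd h3 (longStart_none h5 y)
    · rename_i Δ h5
      obtain ⟨z, rfl, h6, h7⟩ := longStart_some h5
      refine ⟨_, _, rfl, h6, ?_, ?_⟩
      · rintro ⟨t, u⟩ hΔ
        have h8 := h2 t (Multiset.mem_map.2 ⟨_, hΔ, rfl⟩)
        simp only [Better]
        by_cases h9 : s = t
        · subst h9
          exact Or.inr ⟨rfl, h7 _ hΔ⟩
        · left; omega
      · apply usAux_chain hg _ _ h6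
        exact Multiset.card_le_card (Multiset.filter_le _ _)

lemma usDecomp_dec {a b : ℤ} : ∀ (k : ℕ) (n : Multiset Seg), Good a b n → n.card ≤ k →
    Dec n (usDecomp k n) := by
  intro k
  induction k with
  | zero =>
    intro n _ hk
    have : n = 0 := Multiset.card_eq_zero.1 (by omega)
    subst this
    exact Dec.nil
  | succ k ih =>
    intro n hg hk
    rw [usDecomp]
    split_ifs with h0
    · subst h0
      exact Dec.nil
    · obtain ⟨p, L, h1, h2⟩ := usList_row hg h0
      rw [h1]
      have hle := h2.le
      refine Dec.cons _ _ _ _ _ h2 (add_tsub_cancel_of_le hle).symm (ih _ ?_ ?_)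
      · exact hg.mono (Multiset.subset_of_le (Multiset.sub_le_self _ _))
      · rw [Multiset.card_sub hle]
        simp
        omega

lemma sel_spec {a b : ℤ} (hab : a ≤ b) {n : Multiset Seg} {rows : List (List Seg)}
    (h : Dec n rows) : Good a b n → ∀ P : List (List Seg), ∃ l : List (Seg × ℤ),
      selAuxD (P ++ rows) (P.length + rows.length) b =
        l ++ selAuxD (P ++ rows) P.length ((wk b rows).1 - 1) ∧
      ((l.map Prod.fst : List Seg) : Multiset Seg) = (wk b rows).2.1 ∧
      ((l.map (fun q => (q.2, q.1.2)) : List Seg) : Multiset Seg) = (wk b rows).2.2 ∧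
      ((rows = [] ∧ l = []) ∨ ∃ l0 Δ y, l = l0 ++ [(Δ, y)] ∧ Δ.1 = (wk b rows).1) := by
  induction h with
  | nil =>
    intro _ P
    exact ⟨[], by simp [wk], by simp [wk], by simp [wk], Or.inl ⟨rfl, rfl⟩⟩
  | cons n n1 p L rows hr hn hd ih =>
    intro hg P
    obtain ⟨l, h1, h2, h3, -⟩ := ih (hg.mono (row_sub hn)) (P ++ [p :: L])
    obtain ⟨-, Δ, -, -, hf, -⟩ := row_pick hab hr hn hd hg
    have hw := wk_cons hf
    have e1 : P ++ [p :: L] ++ rows = P ++ (p :: L) :: rows := by simp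
    have e2 : (P ++ [p :: L]).length + rows.length = P.length + ((p :: L) :: rows).length := by
      simp; omega
    have e3 : (P ++ [p :: L]).length = P.length + 1 := by simp
    rw [e1, e2, e3] at h1
    refine ⟨l ++ [(Δ, (wk b rows).1)], ?_, ?_, ?_, Or.inr ⟨l, Δ, _, rfl, by rw [hw]⟩⟩
    · rw [h1, selAuxD]
      have e4 : (P ++ (p :: L) :: rows).getD P.length [] = p :: L := by simp
      rw [e4, hf, hw]
      simp
    · rw [hw, ← h2]
      simp only [List.map_append, List.map_cons, List.map_nil, ← Multiset.coe_add]
      rw [add_comm]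
      rfl
    · rw [hw, ← h3]
      simp only [List.map_append, List.map_cons, List.map_nil, ← Multiset.coe_add]
      rw [add_comm]
      rfl

/-- discard void segments -/
def nv (n : Multiset Seg) : Multiset Seg := n.filter fun Δ => Δ.1 ≤ Δ.2

lemma pushSeg_eq (m : Multiset Seg) (x y : ℤ) : pushSeg m x y = m + nv {(x, y)} := by
  unfold pushSeg nv
  split_ifs with h
  · rw [Multiset.filter_singleton, if_pos h]
  · rw [Multiset.filter_singleton, if_neg h]; simp

lemma nv_add (n n' : Multiset Seg) : nv (n + n') = nv n + nv n' := Multiset.filter_add _ _ _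

lemma fold_spec : ∀ (l : List (Seg × ℤ)) (acc : Multiset Seg),
    ((l.map Prod.fst : List Seg) : Multiset Seg) ≤ acc →
    l.foldl (fun acc p => pushSeg (acc.erase p.1) p.2 p.1.2) acc +
      ((l.map Prod.fst : List Seg) : Multiset Seg) =
    acc + nv ((l.map (fun q => (q.2, q.1.2)) : List Seg) : Multiset Seg) := by
  intro l
  induction l with
  | nil => intro acc _; simp [nv]
  | cons q l ih =>
    intro acc h
    simp only [List.map_cons, ← Multiset.cons_coe] at h ⊢
    have hq : q.1 ∈ acc := Multiset.mem_of_le h (by simp)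
    have h1 : ((l.map Prod.fst : List Seg) : Multiset Seg) ≤ acc.erase q.1 := by
      rw [← Multiset.cons_erase hq] at h
      exact (Multiset.cons_le_cons_iff _).1 h
    have h2 := ih (pushSeg (acc.erase q.1) q.2 q.1.2)
      (h1.trans (by rw [pushSeg_eq]; exact Multiset.le_add_right _ _))
    rw [List.foldl_cons, Multiset.add_cons, h2, pushSeg_eq, ← Multiset.singleton_add (q.2, q.1.2),
      nv_add, add_assoc, ← Multiset.cons_add, Multiset.cons_erase hq]

lemma mRange_good (m : Multiset Seg) (a b : ℤ) : Good a b (mRange m a b) :=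
  fun _ hΔ => (Multiset.mem_filter.1 hΔ).2

lemma DL_none {a b : ℤ} (hab : a ≤ b) {m : Multiset Seg} {rows : List (List Seg)}
    (h : Dec (mRange m a b) rows) (hx : (wk b rows).1 ≠ a) : DLang a b m = none := by
  have hg := mRange_good m a b
  have hrows := (usDecomp_dec _ _ hg le_rfl).unique _ h
  obtain ⟨l, h1, h2, h3, h4⟩ := sel_spec hab h hg []
  simp only [List.nil_append, List.length_nil, zero_add, selAuxD, List.append_nil] at h1
  unfold DLang
  simp only [hrows, h1]
  rcases h4 with ⟨-, rfl⟩ | ⟨l0, Δ, y, rfl, h4⟩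
  · simp
  · simp [h4, hx]

lemma DL_some {a b : ℤ} (hab : a ≤ b) {m : Multiset Seg} {rows : List (List Seg)}
    (h : Dec (mRange m a b) rows) (hx : (wk b rows).1 = a) :
    ∃ r, DLang a b m = some r ∧ r + (wk b rows).2.1 = m + nv (wk b rows).2.2 := by
  have hg := mRange_good m a b
  have hrows := (usDecomp_dec _ _ hg le_rfl).unique _ h
  obtain ⟨l, h1, h2, h3, h4⟩ := sel_spec hab h hg []
  simp only [List.nil_append, List.length_nil, zero_add, selAuxD, List.append_nil] at h1
  have hle : ((l.map Prod.fst : List Seg) : Multiset Seg) ≤ m := by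
    rw [h2]
    exact (wk_spec hab h hg).old_le.trans (Multiset.filter_le _ _)
  have hfold := fold_spec l m hle
  rw [h2, h3] at hfold
  refine ⟨_, ?_, hfold⟩
  unfold DLang
  simp only [hrows, h1]
  rcases h4 with ⟨rfl, -⟩ | ⟨l0, Δ, y, rfl, h4⟩
  · simp [wk] at hx
    omega
  · simp [h4, hx]

/-- appending a void segment -/
lemma void_dec {a b : ℤ} (hab : a ≤ b) {n : Multiset Seg} {rows : List (List Seg)}
    (h : Dec n rows) : Good a b n →
    ∃ rows', Dec ((b + 1, b) ::ₘ n) rows' ∧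
      wk b rows' = ((wk b rows).1, (b + 1, b) ::ₘ (wk b rows).2.1,
        (b + 1, b) ::ₘ (wk b rows).2.2) := by
  induction h with
  | nil =>
    intro _
    refine ⟨[[(b + 1, b)]], Dec.cons _ 0 _ _ _ ⟨by simp, ?_, ?_⟩ (by simp) Dec.nil, ?_⟩
    · intro Δ hΔ
      simp at hΔ
      subst hΔ
      right; simp
    · refine Chain.nil _ fun Δ hΔ hl => ?_
      simp at hΔ
      subst hΔ
      simp [Lt] at hl
    · rw [wk_cons (Δ := (b + 1, b))]
      · simp [wk]
      · exact fr_head _ _ _ rfl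
  | cons n n1 p L rows hr hn hd ih =>
    intro hg
    obtain ⟨rows', h1, h2⟩ := ih (hg.mono (row_sub hn))
    obtain ⟨-, Δ, -, -, hf, -⟩ := row_pick hab hr hn hd hg
    have hf' : findRowD (p :: L) ((wk b rows').1 - 1) = some Δ := by rw [h2]; exact hf
    refine ⟨(p :: L) :: rows', Dec.cons _ ((b + 1, b) ::ₘ n1) _ _ _ ⟨?_, ?_, ?_⟩ ?_ h1, ?_⟩
    · exact Multiset.mem_cons_of_mem hr.mem
    · intro Δ hΔ
      rcases Multiset.mem_cons.1 hΔ with rfl | hΔ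
      · have := hg _ hr.mem
        unfold Better
        simp only
        omega
      · exact hr.best _ hΔ
    · apply hr.chain.congr
      intro Δ
      constructor
      · rintro ⟨h3, h4⟩
        exact ⟨Multiset.mem_cons_of_mem h3, h4⟩
      · rintro ⟨h3, h4⟩
        refine ⟨?_, h4⟩
        rcases Multiset.mem_cons.1 h3 with rfl | h3
        · have := hg _ hr.mem
          simp only [Lt] at h4
          omega
        · exact h3
    · rw [Multiset.add_cons, hn]
    · rw [wk_cons hf', wk_cons hf, h2]
      simp only
      rw [Multiset.cons_swap Δ (b + 1, b),
        Multiset.cons_swap ((wk b rows).1, Δ.2) (b + 1, b)]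


lemma phi_nv (a : ℤ) (n : Multiset Seg) (x : ℤ) (hx : a ≤ x) : phi a (nv n) x = phi a n x := by
  induction n using Multiset.induction with
  | empty => simp [nv]
  | cons Δ n ih =>
    rw [← Multiset.singleton_add, nv_add, phi_add, phi_add, ih]
    congr 1
    unfold nv
    rw [Multiset.filter_singleton]
    split_ifs with h
    · rfl
    · obtain ⟨s, y⟩ := Δ
      simp only at h
      simp only [phi, ind, Multiset.map_singleton, Multiset.sum_singleton, Multiset.empty_eq_zero,
        Multiset.map_zero, Multiset.sum_zero]
      split_ifs <;> omega

lemma phi_mRange (a b : ℤ) (hab : a ≤ b) (m : Multiset Seg) (x : ℤ) (hx : b ≤ x) :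
    phi a (mRange m a b) x = phi a m x := by
  induction m using Multiset.induction with
  | empty => simp [mRange]
  | cons Δ n ih =>
    rw [← Multiset.singleton_add, mRange, Multiset.filter_add, phi_add, phi_add]
    rw [mRange] at ih
    rw [ih]
    congr 1
    rw [Multiset.filter_singleton]
    split_ifs with h
    · rfl
    · obtain ⟨s, y⟩ := Δ
      simp only at h
      simp only [phi, ind, Multiset.map_singleton, Multiset.sum_singleton, Multiset.empty_eq_zero,
        Multiset.map_zero, Multiset.sum_zero]
      split_ifs <;> omega

lemma IsMS_r {m r O N : Multiset Seg} (hm : IsMS m) (h : r + O = m + nv N) : IsMS r := by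
  intro Δ hΔ
  have : Δ ∈ m + nv N := by rw [← h]; exact Multiset.mem_add.2 (Or.inl hΔ)
  rcases Multiset.mem_add.1 this with h1 | h1
  · exact hm _ h1
  · exact (Multiset.mem_filter.1 h1).2

lemma nv_MS {m : Multiset Seg} (hm : IsMS m) : nv m = m := Multiset.filter_eq_self.2 hm

lemma PK_r {a b K e' : ℤ} {m r : Multiset Seg} {rows : List (List Seg)} (hm : IsMS m)
    (h : r + (wk b rows).2.1 = m + nv (wk b rows).2.2) (hae : a ≤ e')
    (h1 : ∀ x, a ≤ x → phi a m x + dl a b rows x ≤ K) (h2 : phi a m e' + dl a b rows e' = K)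
    (h3 : ∀ x, e' < x → phi a m x + dl a b rows x < K) : PK (phi a r) K e' := by
  have hr := IsMS_r hm h
  have hphi : ∀ x, a ≤ x → phi a r x = phi a m x + dl a b rows x := by
    intro x hx
    have h4 := congrArg (fun s => phi a s x) h
    simp only [phi_add, phi_nv a _ x hx] at h4
    unfold dl
    omega
  refine ⟨fun x => ?_, by rw [hphi _ hae, h2], fun x hx => ?_⟩
  · by_cases hx : a ≤ x
    · rw [hphi _ hx]
      exact h1 x hx
    · have h5 := phi_le a r x a (by omega) (fun y hy _ => by
        have := hr _ hy
        exact this)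
      have h6 := hphi a le_rfl
      have := h1 a le_rfl
      omega
  · rw [hphi _ (by omega)]
    exact h3 x hx

lemma push_eq {m : Multiset Seg} {a e : ℤ} (h : (a, e) ∈ m) :
    pushSeg (m.erase (a, e)) (a + 1) e + {(a, e)} = m + nv {(a + 1, e)} := by
  rw [pushSeg_eq, add_right_comm, add_comm (m.erase (a, e)), Multiset.singleton_add,
    Multiset.cons_erase h]

lemma fin_lemma {m : Multiset Seg} (hm : IsMS m) {a b : ℤ} (hab : a ≤ b) {M e : ℤ}
    (hpk : PK (phi a m) M e) {rows rows' : List (List Seg)}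
    (hd : Dec (mRange m a b) rows)
    (hd' : Dec (mRange (pushSeg (m.erase (a, e)) (a + 1) e) a b) rows')
    (hiff : (wk b rows').1 = a ↔ (wk b rows).1 = a)
    (hkey : (wk b rows).1 = a → ∃ M' e', a ≤ e' ∧
      (wk b rows').2.2 + (wk b rows).2.1 + {(a + 1, e)} + {(a, e')} =
        (wk b rows).2.2 + (wk b rows').2.1 + {(a, e)} + {(a + 1, e')} ∧
      ∀ r, r + (wk b rows).2.1 = m + nv (wk b rows).2.2 → PK (phi a r) M' e') :
    (DLang a b m ≠ none →
      (DLang a b m).bind (Drho a) = (Drho a m).bind (DLang a b) ∧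
        (DLang a b m).bind (Drho a) ≠ none) ∧
    ((Drho a m).bind (DLang a b) ≠ none → DLang a b m ≠ none) := by
  rw [DR1 hm hpk]
  simp only [Option.bind_some]
  by_cases hx : (wk b rows).1 = a
  swap
  · rw [DL_none hab hd hx, DL_none hab hd' (fun h => hx (hiff.1 h))]
    simp
  obtain ⟨M', e', hae', heq, hPK⟩ := hkey hx
  obtain ⟨r, hr1, hr2⟩ := DL_some hab hd hx
  obtain ⟨r', hr1', hr2'⟩ := DL_some hab hd' (hiff.2 hx)
  have hmsr := IsMS_r hm hr2
  have hpkr := hPK r hr2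
  have hq := push_eq hpkr.mem
  have hmem := hpk.mem
  have hm' := push_eq hmem
  have hmsm' := IsMS_r hm hm'
  have hO : nv (wk b rows).2.1 = (wk b rows).2.1 := nv_MS fun Δ hΔ => hm _
    (Multiset.mem_of_le ((wk_spec hab hd (mRange_good _ _ _)).old_le.trans
      (Multiset.filter_le _ _)) hΔ)
  have hO' : nv (wk b rows').2.1 = (wk b rows').2.1 := nv_MS fun Δ hΔ => hmsm' _
    (Multiset.mem_of_le ((wk_spec hab hd' (mRange_good _ _ _)).old_le.trans
      (Multiset.filter_le _ _)) hΔ)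
  have he : nv {(a, e)} = {(a, e)} := nv_MS fun Δ hΔ => by
    rw [Multiset.mem_singleton.1 hΔ]; exact hm _ hmem
  have he' : nv {(a, e')} = {(a, e')} := nv_MS fun Δ hΔ => by
    rw [Multiset.mem_singleton.1 hΔ]; exact hae'
  have heq2 := congrArg nv heq
  simp only [nv_add, hO, hO', he, he'] at heq2
  rw [hr1, hr1']
  simp only [Option.bind_some]
  rw [DR1 hmsr hpkr]
  refine ⟨fun _ => ⟨?_, by simp⟩, fun _ => by simp⟩
  congr 1
  generalize pushSeg (r.erase (a, e')) (a + 1) e' = q at *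
  generalize pushSeg (m.erase (a, e)) (a + 1) e = m' at *
  ext x
  have c1 := congrArg (Multiset.count x) hr2
  have c2 := congrArg (Multiset.count x) hr2'
  have c3 := congrArg (Multiset.count x) hq
  have c4 := congrArg (Multiset.count x) hm'
  have c5 := congrArg (Multiset.count x) heq2
  simp only [Multiset.count_add] at c1 c2 c3 c4 c5
  omega

lemma mRange_add (m m' : Multiset Seg) (a b : ℤ) :
    mRange (m + m') a b = mRange m a b + mRange m' a b := Multiset.filter_add _ _ _

lemma mRange_single (Δ : Seg) (a b : ℤ) :
    mRange {Δ} a b = if a ≤ Δ.1 ∧ Δ.1 ≤ b + 1 ∧ b ≤ Δ.2 then {Δ} else 0 :=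
  Multiset.filter_singleton _

lemma caseB {m : Multiset Seg} (hm : IsMS m) {a b : ℤ} (hab : a ≤ b) {M e : ℤ}
    (hpk : PK (phi a m) M e) (heb : e < b) :
    (DLang a b m ≠ none →
      (DLang a b m).bind (Drho a) = (Drho a m).bind (DLang a b) ∧
        (DLang a b m).bind (Drho a) ≠ none) ∧
    ((Drho a m).bind (DLang a b) ≠ none → DLang a b m ≠ none) := by
  have hmem := hpk.mem
  have hae := hm _ hmem
  simp only at hae
  have hd := usDecomp_dec _ _ (mRange_good m a b) le_rfl
  generalize usDecomp _ _ = rows at hd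
  have hr : mRange (pushSeg (m.erase (a, e)) (a + 1) e) a b = mRange m a b := by
    have h := congrArg (fun s => mRange s a b) (push_eq hmem)
    simp only [mRange_add, mRange_single] at h
    rw [if_neg (by omega)] at h
    have h2 : mRange (nv {(a + 1, e)}) a b = 0 := by
      unfold nv
      rw [Multiset.filter_singleton]
      split_ifs
      · rw [mRange_single, if_neg (by simp only; omega)]
      · rfl
    rw [h2] at h
    simpa using h
  refine fin_lemma hm hab hpk hd (rows' := rows) (by rw [hr]; exact hd) Iff.rfl fun hx => ?_
  refine ⟨M - 1, e, hae, add_right_comm _ _ _, fun r hr => ?_⟩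
  have hphi := phi_mRange a b hab m
  obtain ⟨s1, s2⟩ := SB (by omega) hd (M - 1) (mRange_good m a b) (by
    intro x
    by_cases hxb : b ≤ x
    · have := hpk.lt x (by omega)
      rw [hphi x hxb]
      omega
    · have h1 := phi_le a (mRange m a b) x b (by omega)
        (fun y hy _ => (mRange_good m a b _ hy).2.2)
      have h2 := hpk.lt b heb
      rw [hphi b le_rfl] at h1
      omega) hx
  apply PK_r hm hr hae
  · intro x _
    by_cases hxb : b ≤ x
    · have := s1 x
      rw [hphi x hxb] at this
      omega
    · have := s2 x (by omega)
      have := hpk.le x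
      omega
  · have := s2 e heb
    have := hpk.eq
    omega
  · intro x hxe
    by_cases hxb : b ≤ x
    · have := s1 x
      rw [hphi x hxb] at this
      omega
    · have := s2 x (by omega)
      have := hpk.lt x hxe
      omega

lemma caseA {m : Multiset Seg} (hm : IsMS m) {a b : ℤ} (hab : a ≤ b) {M e : ℤ} (hM : 2 ≤ M)
    (hpk : PK (phi a m) M e) (hbe : b ≤ e) :
    (DLang a b m ≠ none →
      (DLang a b m).bind (Drho a) = (Drho a m).bind (DLang a b) ∧
        (DLang a b m).bind (Drho a) ≠ none) ∧
    ((Drho a m).bind (DLang a b) ≠ none → DLang a b m ≠ none) := by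
  have hmem := hpk.mem
  have hg := mRange_good m a b
  have hd := usDecomp_dec _ _ hg le_rfl
  generalize usDecomp _ _ = rows at hd
  have hphi := phi_mRange a b hab m
  have hpkn : PK (phi a (mRange m a b)) M e := by
    refine ⟨fun x => ?_, by rw [hphi _ hbe, hpk.eq], fun x hx => ?_⟩
    · by_cases hxb : b ≤ x
      · rw [hphi x hxb]
        exact hpk.le x
      · have h1 := phi_le a (mRange m a b) x b (by omega) (fun y hy _ => (hg _ hy).2.2)
        have h2 := hpk.le b
        rw [hphi b le_rfl] at h1
        omega
    · rw [hphi x (by omega)]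
      exact hpk.lt x hx
  obtain ⟨rowsS, hdS, hS⟩ := S hab hd M e hg (by omega) hpkn
  have herase : mRange (m.erase (a, e)) a b = (mRange m a b).erase (a, e) := by
    conv_rhs => rw [← Multiset.cons_erase hmem, ← Multiset.singleton_add, mRange_add,
      mRange_single, if_pos (by simp only; omega), Multiset.singleton_add,
      Multiset.erase_cons_head]
  obtain ⟨rows', hd', hX', hNO'⟩ : ∃ rows',
      Dec (mRange (pushSeg (m.erase (a, e)) (a + 1) e) a b) rows' ∧
      (wk b rows').1 = (wk b rowsS).1 ∧
      (wk b rows').2.2 + (wk b rowsS).2.1 = (wk b rowsS).2.2 + (wk b rows').2.1 := by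
    unfold pushSeg
    split_ifs with hv
    · refine ⟨rowsS, ?_, rfl, rfl⟩
      rw [mRange_add, mRange_single, if_pos (by simp only; omega), herase, add_comm,
        Multiset.singleton_add]
      exact hdS
    · rw [herase]
      have hg0 : Good a b ((mRange m a b).erase (a, e)) :=
        hg.mono (Multiset.erase_subset _ _)
      have hd0 := usDecomp_dec _ _ hg0 le_rfl
      generalize usDecomp _ _ = rows0 at hd0
      obtain ⟨rows1, hd1, hw1⟩ := void_dec hab hd0 hg0
      have e1 : a = b := by omega
      have e2 : e = b := by omega
      have h1 : rows1 = rowsS := by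
        apply hd1.unique
        rw [← e1]
        rw [← e1] at e2
        rw [e2] at hdS ⊢
        exact e1 ▸ hdS
      refine ⟨rows0, hd0, ?_, ?_⟩
      · rw [← h1, hw1]
      · rw [← h1, hw1]
        simp only [Multiset.add_cons, Multiset.cons_add]
  have hPKr : ∀ e', (wk b rows).1 = a → (a, e') ∈ mRange m a b →
      PK (fun x => phi a (mRange m a b) x + dl a b rows x) (M - 1) e' →
      ∀ r, r + (wk b rows).2.1 = m + nv (wk b rows).2.2 → PK (phi a r) (M - 1) e' := by
    intro e' hx he' hp r hr
    have hbe' := (hg _ he').2.2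
    simp only at hbe'
    apply PK_r hm hr (by omega)
    · intro x hax
      by_cases hxb : b ≤ x
      · rw [← hphi x hxb]
        exact hp.le x
      · obtain ⟨-, s2⟩ := SB (by omega) hd M hg hpkn.le hx
        have := s2 x (by omega)
        have := hpk.le x
        omega
    · rw [← hphi _ hbe']
      exact hp.eq
    · intro x hxe
      rw [← hphi _ (by omega)]
      exact hp.lt x hxe
  have hae := hm _ hmem
  simp only at hae
  rcases hS with ⟨h1, h2, h3, -⟩ | ⟨h1, -, h3⟩
  · refine fin_lemma hm hab hpk hd hd' (by rw [hX', h1]) fun hx => ?_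
    refine ⟨M - 1, e, hae, ?_, hPKr e hx hpkn.mem (h3 hx)⟩
    rw [add_right_comm]
    congr 2
    ext x
    have c1 := congrArg (Multiset.count x) h2
    have c2 := congrArg (Multiset.count x) hNO'
    simp only [Multiset.count_add] at c1 c2 ⊢
    omega
  · obtain ⟨h4, e', h5, h6, h7⟩ := h3 hM
    refine fin_lemma hm hab hpk hd hd' (by rw [hX', h1, h4]) fun hx => ?_
    refine ⟨M - 1, e', ?_, ?_, hPKr e' hx h5 h7⟩
    · have := (hg _ h5).2.2
      simp only at this
      omega
    · ext x
      have c1 := congrArg (Multiset.count x) h6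
      have c2 := congrArg (Multiset.count x) hNO'
      simp only [Multiset.count_add] at c1 c2 ⊢
      omega

/-- if `ε_{[a]}(m) ≥ 2` then (i) whenever `𝒟^Lang_{[a,b]}(m) ≠ ∞`,
`𝒟_{[a]} ∘ 𝒟^Lang_{[a,b]}(m) = 𝒟^Lang_{[a,b]} ∘ 𝒟_{[a]}(m) ≠ ∞`; and (ii) if
`𝒟^Lang_{[a,b]} ∘ 𝒟_{[a]}(m) ≠ ∞` then `𝒟^Lang_{[a,b]}(m) ≠ ∞`. -/
theorem stmt3 (m : Multiset Seg) (hm : IsMS m) (a b : ℤ) (hab : a ≤ b)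
    (heps : 2 ≤ epsA a m) :
    (DLang a b m ≠ none →
      (DLang a b m).bind (Drho a) = (Drho a m).bind (DLang a b) ∧
        (DLang a b m).bind (Drho a) ≠ none) ∧
    ((Drho a m).bind (DLang a b) ≠ none → DLang a b m ≠ none) := by
  obtain ⟨e, hpk⟩ := DR2 hm (show 1 ≤ epsA a m by omega)
  by_cases hbe : b ≤ e
  · exact caseA hm hab (by exact_mod_cast heps) hpk hbe
  · exact caseB hm hab hpk (by omega)

end Multiseg
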